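/- arXiv:1105.4314 — 9 statements merged into one kernel-verified Lean document; each statement's English description precedes it below -/
import Mathlib

section
/- For integers $s$ and $t$ with $2 \le s \le t$, the complete bipartite graph $K_{s,t}$ satisfies $rc(K_{s,t}) = \min\{\lceil t^{1/s} \rceil, 4\}$. -/
open SimpleGraph

/-- An edge-coloring `c` of `G` is rainbow (for connectivity) if every two distinct
vertices are joined by a path whose edges receive pairwise distinct colors. -/
def IsRainbowEdgeColoring {V : Type*} (G : SimpleGraph V) {α : Type*} (c : Sym2 V → α) : Prop :=
  ∀ u v : V, u ≠ v → ∃ p : G.Walk u v, p.IsPath ∧ (p.edges.map c).Nodup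

/-- The rainbow connection number of `G`: the least `k` admitting a `k`-rainbow
edge-coloring. -/
noncomputable def rainbowConnNum {V : Type*} (G : SimpleGraph V) : ℕ :=
  sInf {k | ∃ c : Sym2 V → Fin k, IsRainbowEdgeColoring G c}

/-- `⌈t^{1/s}⌉` for naturals: the least natural number `x` with `t ≤ x ^ s`. -/
noncomputable def ceilRoot (s t : ℕ) : ℕ :=
  sInf {x : ℕ | t ≤ x ^ s}

/-- An edge-coloring of `completeBipartiteGraph α β` read off from a family of color codes:
the edge joining `a` and `b` gets color `f b a`. -/
def codeColoring {α β γ : Type*} [Inhabited γ] (f : β → α → γ) : Sym2 (α ⊕ β) → γ :=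
  Sym2.lift ⟨fun u v => match u, v with
    | .inl a, .inr b => f b a
    | .inr b, .inl a => f b a
    | _, _ => default, by rintro (a | b) (a' | b') <;> rfl⟩

@[simp] lemma codeColoring_inl_inr {α β γ : Type*} [Inhabited γ] (f : β → α → γ) (a : α) (b : β) :
    codeColoring f s(.inl a, .inr b) = f b a := rfl

@[simp] lemma codeColoring_inr_inl {α β γ : Type*} [Inhabited γ] (f : β → α → γ) (a : α) (b : β) :
    codeColoring f s(.inr b, .inl a) = f b a := rfl

lemma isRainbowEdgeColoring_codeColoring {α β γ : Type*} [Inhabited γ] (f : β → α → γ)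
    (hα : ∀ a a', a ≠ a' → ∃ b, f b a ≠ f b a')
    (hβ : ∀ b b', b ≠ b' → (∃ a, f b a ≠ f b' a) ∨ ∃ a a' b'', a ≠ a' ∧ b'' ≠ b ∧ b'' ≠ b' ∧
      [f b a, f b'' a, f b'' a', f b' a'].Nodup) :
    IsRainbowEdgeColoring (completeBipartiteGraph α β) (codeColoring f) := by
  have hl (a : α) (b : β) : (completeBipartiteGraph α β).Adj (.inl a) (.inr b) := by simp
  have hr (a : α) (b : β) : (completeBipartiteGraph α β).Adj (.inr b) (.inl a) := by simp
  rintro (a | b) (a' | b') h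
  · have h' : a ≠ a' := by simpa using h
    obtain ⟨b, hb⟩ := hα a a' h'
    exact ⟨.cons (hl a b) (.cons (hr a' b) .nil), by simp [h'], by simpa using hb⟩
  · exact ⟨.cons (hl a b') .nil, by simp, by simp⟩
  · exact ⟨.cons (hr a' b) .nil, by simp, by simp⟩
  · have h' : b ≠ b' := by simpa using h
    obtain ⟨a, ha⟩ | ⟨a, a', b'', haa, hb, hb', hn⟩ := hβ b b' h'
    · exact ⟨.cons (hr a b) (.cons (hl a b') .nil), by simp [h'], by simpa using ha⟩
    · exact ⟨.cons (hr a b) (.cons (hl a b'') (.cons (hr a' b'') (.cons (hl a' b') .nil))),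
        by simp [h', haa, hb', hb.symm], by simpa using hn⟩

/-- With at most three colors, vertices on the same side can only be joined by rainbow paths of
length two, so the color codes of the vertices in one part are pairwise distinct. -/
lemma IsRainbowEdgeColoring.exists_ne {α β : Type*} {k : ℕ} (hk : k < 4)
    {c : Sym2 (α ⊕ β) → Fin k} (hc : IsRainbowEdgeColoring (completeBipartiteGraph α β) c)
    {b b' : β} (hb : b ≠ b') : ∃ a : α, c s(.inl a, .inr b) ≠ c s(.inl a, .inr b') := by
  obtain ⟨p, -, hp⟩ := hc (.inr b) (.inr b') (by simpa using hb)
  have hlen := hp.length_le_card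
  simp only [List.length_map, Walk.length_edges, Fintype.card_fin] at hlen
  match p with
  | .nil => exact absurd rfl hb
  | .cons h .nil => simp at h
  | .cons (v := .inr _) h (.cons _ .nil) => simp at h
  | .cons (v := .inl a) h (.cons h' .nil) =>
    refine ⟨a, ?_⟩
    simpa [Sym2.eq_swap (a := (Sum.inr b : α ⊕ β))] using hp
  | .cons (v := v) h (.cons (v := w) h' (.cons h'' .nil)) =>
    rcases v with v | v <;> rcases w with w | w <;> simp at h h' h''
  | .cons _ (.cons _ (.cons _ (.cons _ _))) =>
    simp only [Walk.length_cons] at hlen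
    omega

lemma le_pow_of_isRainbowEdgeColoring {s t k : ℕ} (hk : k < 4) {c : Sym2 (Fin s ⊕ Fin t) → Fin k}
    (hc : IsRainbowEdgeColoring (completeBipartiteGraph (Fin s) (Fin t)) c) : t ≤ k ^ s := by
  have hinj : Function.Injective fun (b : Fin t) (a : Fin s) => c s(.inl a, .inr b) := by
    intro b b' h
    by_contra hb
    obtain ⟨a, ha⟩ := hc.exists_ne hk hb
    exact ha (congrFun h a)
  simpa using Fintype.card_le_of_injective _ hinj

lemma exists_isRainbowEdgeColoring_of_le_pow {s t k : ℕ} (hk : 2 ≤ k) (hst : s ≤ t)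
    (ht : t ≤ k ^ s) : ∃ c : Sym2 (Fin s ⊕ Fin t) → Fin k,
      IsRainbowEdgeColoring (completeBipartiteGraph (Fin s) (Fin t)) c := by
  obtain ⟨k, rfl⟩ := Nat.exists_eq_add_of_le' hk
  let e : Fin s → Fin s → Fin (k + 2) := fun i => Pi.single i 1
  obtain ⟨T, hT, hcard⟩ := Finset.exists_superset_card_eq (s := Finset.univ.image e) (n := t)
    (Finset.card_image_le.trans (by simpa using hst)) (by simpa using ht)
  let g : Fin t ≃ T := (T.equivFinOfCardEq hcard).symm
  refine ⟨codeColoring fun b => (g b : Fin s → Fin (k + 2)),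
    isRainbowEdgeColoring_codeColoring _ (fun a a' h => ?_) (fun b b' h => .inl ?_)⟩
  · refine ⟨g.symm ⟨e a, hT (by simp)⟩, ?_⟩
    simp [e, Pi.single_eq_of_ne h.symm]
  · rw [← Function.ne_iff]
    exact fun hg => h (g.injective (Subtype.ext hg))

lemma exists_isRainbowEdgeColoring_four {s t : ℕ} (hs : 2 ≤ s) (hst : s ≤ t) :
    ∃ c : Sym2 (Fin s ⊕ Fin t) → Fin 4,
      IsRainbowEdgeColoring (completeBipartiteGraph (Fin s) (Fin t)) c := by
  let f : Fin t → Fin s → Fin 4 := fun b a =>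
    if b.val < s then (if a.val = b.val then 1 else 0) else (if a.val = 0 then 2 else 3)
  refine ⟨codeColoring f, isRainbowEdgeColoring_codeColoring _ (fun a a' h => ?_)
    (fun b b' h => ?_)⟩
  · refine ⟨Fin.castLE hst a, ?_⟩
    simp [f, Fin.val_ne_of_ne h.symm]
  · have h' := Fin.val_ne_of_ne h
    by_cases hb : b.val < s
    · refine .inl ⟨⟨b, hb⟩, ?_⟩
      simp only [f, hb, if_true, h', if_false]
      split_ifs <;> decide
    by_cases hb' : b'.val < s
    · refine .inl ⟨⟨b', hb'⟩, ?_⟩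
      simp only [f, hb, hb', if_true, if_false]
      split_ifs <;> decide
    · refine .inr ⟨⟨0, by omega⟩, ⟨1, by omega⟩, ⟨0, by omega⟩, by simp, ?_, ?_, ?_⟩
      · intro h0
        exact hb (h0 ▸ (by omega : 0 < s))
      · intro h0
        exact hb' (h0 ▸ (by omega : 0 < s))
      · have : 0 < s := by omega
        simp [f, hb, hb', this]

lemma le_ceilRoot_pow {s : ℕ} (hs : s ≠ 0) (t : ℕ) : t ≤ ceilRoot s t ^ s :=
  Nat.sInf_mem (s := {x : ℕ | t ≤ x ^ s}) ⟨t, Nat.le_self_pow hs t⟩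

theorem rc_completeBipartite (s t : ℕ) (hs : 2 ≤ s) (hst : s ≤ t) :
    rainbowConnNum (completeBipartiteGraph (Fin s) (Fin t)) = min (ceilRoot s t) 4 := by
  have h4 := exists_isRainbowEdgeColoring_four hs hst
  have ht := le_ceilRoot_pow (by omega : s ≠ 0) t
  have h2 : 2 ≤ ceilRoot s t := by
    by_contra! h
    have := ht.trans (Nat.pow_le_pow_left (Nat.le_of_lt_succ h) s)
    rw [one_pow] at this
    omega
  apply le_antisymm
  · exact le_min (Nat.sInf_le (exists_isRainbowEdgeColoring_of_le_pow h2 hst ht)) (Nat.sInf_le h4)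
  · refine le_csInf ⟨4, h4⟩ ?_
    rintro k ⟨c, hc⟩
    by_cases hk : k < 4
    · exact (min_le_left _ _).trans (Nat.sInf_le (le_pow_of_isRainbowEdgeColoring hk hc))
    · exact (min_le_right _ _).trans (not_lt.mp hk)
end

section
/- Let $e_2(n)$ denote the minimum number of edges of a simple graph of order $n$ with rainbow connection number $2$. Then $\lim_{n\to\infty} \frac{e_2(n)}{n \log_2 n} = 1$. -/
open SimpleGraph

/-- `e₂(n)`: the minimum number of edges of a graph of order `n` with rainbow
connection number `2`. -/
noncomputable def e2 (n : ℕ) : ℕ :=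
  sInf {m | ∃ G : SimpleGraph (Fin n), rainbowConnNum G = 2 ∧ G.edgeSet.ncard = m}

lemma exists_adj_of_isRainbowEdgeColoring_two {V : Type*} {G : SimpleGraph V}
    {c : Sym2 V → Fin 2} (hc : IsRainbowEdgeColoring G c) {u v : V} (huv : u ≠ v)
    (h : ¬ G.Adj u v) : ∃ w, G.Adj u w ∧ G.Adj w v ∧ c s(u, w) ≠ c s(w, v) := by
  obtain ⟨p, -, hp⟩ := hc u v huv
  have hlen : p.length ≤ 2 := by simpa using hp.length_le_card
  match p, hp, hlen with
  | .nil, _, _ => exact absurd rfl huv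
  | .cons a .nil, _, _ => exact absurd a h
  | .cons a (.cons b .nil), hp, _ => exact ⟨_, a, b, by simpa using hp⟩
  | .cons _ (.cons _ (.cons _ _)), _, hlen => simp at hlen

lemma two_le_rainbowConnNum {V : Type*} {G : SimpleGraph V} {u v : V} (huv : u ≠ v)
    (h : ¬ G.Adj u v) (hne : {k | ∃ c : Sym2 V → Fin k, IsRainbowEdgeColoring G c}.Nonempty) :
    2 ≤ rainbowConnNum G := by
  refine le_csInf hne ?_
  rintro k ⟨c, hc⟩
  obtain ⟨p, -, hp⟩ := hc u v huv
  have hlen : p.length ≤ k := by simpa using hp.length_le_card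
  by_contra! hk
  have : p.length ≠ 0 := fun h0 => huv (Walk.eq_of_length_eq_zero h0)
  exact h (Walk.adj_of_length_eq_one (p := p) (by lia))

/-- The join of the complete graph on the vertices `i < k` of `Fin n` with the empty graph on the
remaining vertices. -/
def hubGraph (n k : ℕ) : SimpleGraph (Fin n) where
  Adj i j := i ≠ j ∧ ((i : ℕ) < k ∨ (j : ℕ) < k)
  symm := ⟨fun _ _ h => ⟨h.1.symm, h.2.symm⟩⟩
  loopless := ⟨fun _ h => h.1 rfl⟩

/-- Colors the edge between a hub `i` and a larger vertex `j` by the `i`-th binary digit of `j`. -/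
def bitColoring (n : ℕ) : Sym2 (Fin n) → Fin 2 :=
  Sym2.lift ⟨fun i j => if Nat.testBit (max (i : ℕ) j) (min (i : ℕ) j) then 1 else 0,
    fun i j => by simp only [max_comm, min_comm]⟩

lemma isRainbowEdgeColoring_bitColoring {n k : ℕ} (hn : n ≤ 2 ^ k) :
    IsRainbowEdgeColoring (hubGraph n k) (bitColoring n) := by
  intro u v huv
  by_cases h : (hubGraph n k).Adj u v
  · exact ⟨.cons h .nil, by simpa using huv, by simp⟩
  have hk : k ≤ (u : ℕ) ∧ k ≤ (v : ℕ) := by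
    simpa [hubGraph, huv, not_or] using h
  have huv' : (u : ℕ) ≠ v := fun e => huv (Fin.ext e)
  obtain ⟨i, hi⟩ := Nat.exists_testBit_ne_of_ne huv'
  have hik : i < k := by
    by_contra! hki
    have hpow : 2 ^ k ≤ 2 ^ i := Nat.pow_le_pow_right two_pos hki
    apply hi
    rw [Nat.testBit_lt_two_pow (u.2.trans_le (hn.trans hpow)),
      Nat.testBit_lt_two_pow (v.2.trans_le (hn.trans hpow))]
  have hin : i < n := by have := u.2; lia
  have hui : u ≠ ⟨i, hin⟩ := by rintro rfl; simp at hk; lia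
  have hvi : v ≠ ⟨i, hin⟩ := by rintro rfl; simp at hk; lia
  have a : (hubGraph n k).Adj u ⟨i, hin⟩ := ⟨hui, Or.inr hik⟩
  have b : (hubGraph n k).Adj ⟨i, hin⟩ v := ⟨hvi.symm, Or.inl hik⟩
  refine ⟨.cons a (.cons b .nil), ?_, ?_⟩
  · simp [hui, huv, hvi.symm]
  · have h1 : i ≤ u := by lia
    have h2 : i ≤ v := by lia
    simp only [Walk.edges_cons, Walk.edges_nil, List.map_cons, List.map_nil, bitColoring,
      Sym2.lift_mk, max_eq_left h1, min_eq_right h1, max_eq_right h2, min_eq_left h2]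
    revert hi
    cases Nat.testBit u i <;> cases Nat.testBit v i <;> simp

lemma rainbowConnNum_hubGraph {n k : ℕ} (hn : n ≤ 2 ^ k) (hk : k + 2 ≤ n) :
    rainbowConnNum (hubGraph n k) = 2 := by
  have hmem : 2 ∈ {m | ∃ c : Sym2 (Fin n) → Fin m, IsRainbowEdgeColoring (hubGraph n k) c} :=
    ⟨_, isRainbowEdgeColoring_bitColoring hn⟩
  refine le_antisymm (Nat.sInf_le hmem) ?_
  refine two_le_rainbowConnNum (u := ⟨k, by lia⟩) (v := ⟨k + 1, by lia⟩) ?_ ?_ ⟨_, hmem⟩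
  · simp
  · simp [hubGraph]

lemma ncard_edgeSet_hubGraph_le (n k : ℕ) : (hubGraph n k).edgeSet.ncard ≤ n * k := by
  have hsub : (hubGraph n k).edgeSet ⊆
      (fun q : ℕ × Fin n => if h : q.1 < n then s(⟨q.1, h⟩, q.2) else s(q.2, q.2)) ''
        ((Finset.range k ×ˢ Finset.univ : Finset (ℕ × Fin n)) : Set (ℕ × Fin n)) := by
    intro e
    induction e with
    | _ i j =>
      rintro ⟨-, h | h⟩
      · exact ⟨(i, j), by simpa using h, by simp⟩
      · exact ⟨(j, i), by simpa using h, by simp [Sym2.eq_swap]⟩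
  calc _ ≤ _ := Set.ncard_le_ncard hsub ((Finset.finite_toSet _).image _)
    _ ≤ _ := Set.ncard_image_le (Finset.finite_toSet _)
    _ = n * k := by rw [Set.ncard_coe_finset]; simp [mul_comm]

lemma clog_two_add_two_le {n : ℕ} (hn : 4 ≤ n) : Nat.clog 2 n + 2 ≤ n := by
  have : n ≤ 2 ^ (n - 2) := by
    induction n, hn using Nat.le_induction with
    | base => norm_num
    | succ m hm ih =>
      rw [show m + 1 - 2 = (m - 2) + 1 by lia, pow_succ]
      lia
  have := Nat.clog_le_of_le_pow this
  lia

lemma e2_le {n : ℕ} (hn : 4 ≤ n) : e2 n ≤ n * Nat.clog 2 n :=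
  le_trans (Nat.sInf_le ⟨_, rainbowConnNum_hubGraph (Nat.le_pow_clog one_lt_two n)
    (clog_two_add_two_le hn), rfl⟩) (ncard_edgeSet_hubGraph_le _ _)

lemma exists_isRainbowEdgeColoring_ncard_eq_e2 {n : ℕ} (hn : 4 ≤ n) :
    ∃ (G : SimpleGraph (Fin n)) (c : Sym2 (Fin n) → Fin 2),
      IsRainbowEdgeColoring G c ∧ G.edgeSet.ncard = e2 n := by
  have hne : {m | ∃ G : SimpleGraph (Fin n), rainbowConnNum G = 2 ∧
      G.edgeSet.ncard = m}.Nonempty :=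
    ⟨_, _, rainbowConnNum_hubGraph (Nat.le_pow_clog one_lt_two n) (clog_two_add_two_le hn), rfl⟩
  obtain ⟨G, hG, he⟩ := Nat.sInf_mem hne
  have hpos : 0 < sInf {k | ∃ c : Sym2 (Fin n) → Fin k, IsRainbowEdgeColoring G c} := by
    change 0 < rainbowConnNum G
    lia
  have hmem := Nat.sInf_mem (Nat.nonempty_of_pos_sInf hpos)
  change rainbowConnNum G ∈ _ at hmem
  rw [hG] at hmem
  obtain ⟨c, hc⟩ := hmem
  exact ⟨G, c, hc, he⟩

section LowerBound

open Finset Classical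

variable {V : Type*} [Fintype V]

/-- The vertices of degree at most `D`. -/
noncomputable def lowVertices (G : SimpleGraph V) (D : ℕ) : Finset V :=
  {v | G.degree v ≤ D}

/-- The neighbors of `v` of degree larger than `D`. -/
noncomputable def highNeighbors (G : SimpleGraph V) (D : ℕ) (v : V) : Finset V :=
  {w ∈ G.neighborFinset v | D < G.degree w}

lemma card_fun_eq_on (s : Finset V) (g : V → Fin 2) :
    #{f : V → Fin 2 | ∀ w ∈ s, f w = g w} * 2 ^ #s = 2 ^ Fintype.card V := by
  have : ({f : V → Fin 2 | ∀ w ∈ s, f w = g w} : Finset (V → Fin 2)) =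
      Fintype.piFinset fun w => if w ∈ s then {g w} else univ := by
    ext f
    simp only [mem_filter, mem_univ, true_and, Fintype.mem_piFinset]
    refine forall_congr' fun w => ?_
    by_cases h : w ∈ s <;> simp [h]
  rw [this, Fintype.card_piFinset]
  have h2 : ∀ w, #(if w ∈ s then {g w} else (univ : Finset (Fin 2))) =
      if w ∈ s then 1 else 2 := by
    intro w; split_ifs <;> simp
  simp only [h2]
  rw [Finset.prod_ite]
  simp only [prod_const_one, one_mul, prod_const]
  rw [← pow_add]
  congr 1
  have := card_filter_add_card_filter_not (s := (univ : Finset V)) (· ∈ s)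
  simp only [filter_univ_mem, card_univ] at this
  lia

lemma card_consistent_le {G : SimpleGraph V} {c : Sym2 V → Fin 2}
    (hc : IsRainbowEdgeColoring G c) (D : ℕ) (f : V → Fin 2) :
    #{v ∈ lowVertices G D | ∀ w ∈ highNeighbors G D v, f w = c s(v, w)} ≤ 1 + D + D * D := by
  set S : Finset V := {v ∈ lowVertices G D | ∀ w ∈ highNeighbors G D v, f w = c s(v, w)} with hS
  rcases S.eq_empty_or_nonempty with h | ⟨u, hu⟩
  · simp [h]
  rw [hS, mem_filter, lowVertices, mem_filter] at hu
  have hsub : S ⊆ ({u} ∪ G.neighborFinset u) ∪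
      ({w ∈ G.neighborFinset u | G.degree w ≤ D}).biUnion fun w => G.neighborFinset w := by
    intro v hv
    rw [hS, mem_filter] at hv
    by_cases huv : u = v
    · simp [huv]
    by_cases hadj : G.Adj u v
    · simp [hadj]
    obtain ⟨w, huw, hwv, hne⟩ := exists_adj_of_isRainbowEdgeColoring_two hc huv hadj
    refine mem_union_right _ (mem_biUnion.2 ⟨w, ?_, by simpa using hwv⟩)
    simp only [mem_filter, mem_neighborFinset, huw, true_and]
    by_contra! hw
    apply hne
    rw [← hu.2 w (by simp [highNeighbors, huw, hw]), Sym2.eq_swap,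
      ← hv.2 w (by simp [highNeighbors, hwv.symm, hw])]
  refine (card_le_card hsub).trans ((card_union_le _ _).trans ?_)
  gcongr
  · refine (card_union_le _ _).trans ?_
    simpa using hu.1.2
  · refine (card_biUnion_le_card_mul _ _ D ?_).trans ?_
    · intro w hw
      simpa using (mem_filter.1 hw).2
    · gcongr
      exact (card_filter_le _ _).trans (by simpa using hu.1.2)

lemma sum_two_pow_highNeighbors_le {G : SimpleGraph V} {c : Sym2 V → Fin 2}
    (hc : IsRainbowEdgeColoring G c) (D : ℕ) :
    ∑ v ∈ lowVertices G D, ((2 : ℝ) ^ #(highNeighbors G D v))⁻¹ ≤ 1 + D + D * D := by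
  have hdouble : ∑ v ∈ lowVertices G D,
      #{f : V → Fin 2 | ∀ w ∈ highNeighbors G D v, f w = c s(v, w)} ≤
      2 ^ Fintype.card V * (1 + D + D * D) := by
    calc _ = ∑ f : V → Fin 2,
        #{v ∈ lowVertices G D | ∀ w ∈ highNeighbors G D v, f w = c s(v, w)} := by
          simp only [card_filter]
          exact sum_comm
      _ ≤ ∑ _f : V → Fin 2, (1 + D + D * D) := sum_le_sum fun f _ => card_consistent_le hc D f
      _ = _ := by simp
  have hcast : ∀ v, ((#{f : V → Fin 2 | ∀ w ∈ highNeighbors G D v, f w = c s(v, w)} : ℕ) : ℝ) =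
      2 ^ Fintype.card V * ((2 : ℝ) ^ #(highNeighbors G D v))⁻¹ := by
    intro v
    rw [eq_mul_inv_iff_mul_eq₀ (by positivity)]
    exact_mod_cast card_fun_eq_on (highNeighbors G D v) fun w => c s(v, w)
  have h : ((∑ v ∈ lowVertices G D,
      #{f : V → Fin 2 | ∀ w ∈ highNeighbors G D v, f w = c s(v, w)} : ℕ) : ℝ) ≤
      2 ^ Fintype.card V * (1 + D + D * D) := by exact_mod_cast hdouble
  rw [Nat.cast_sum, sum_congr rfl fun v _ => hcast v, ← mul_sum] at h
  exact le_of_mul_le_mul_left h (by positivity)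

lemma sum_card_highNeighbors_le (G : SimpleGraph V) (D : ℕ) :
    ∑ v ∈ lowVertices G D, #(highNeighbors G D v) ≤ G.edgeSet.ncard := by
  rw [← card_sigma, ← coe_edgeFinset, Set.ncard_coe_finset]
  refine card_le_card_of_injOn (fun q => s(q.1, q.2)) ?_ ?_
  · rintro ⟨v, w⟩ h
    simp_all [highNeighbors]
  · rintro ⟨v, w⟩ h ⟨v', w'⟩ h' e
    simp only [lowVertices, highNeighbors, coe_sigma, Set.mem_sigma_iff, mem_coe, mem_filter,
      mem_univ, true_and] at h h'
    rcases Sym2.eq_iff.1 e with ⟨rfl, rfl⟩ | ⟨rfl, rfl⟩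
    · rfl
    · lia

lemma card_high_mul_le (G : SimpleGraph V) (D : ℕ) :
    (Fintype.card V - #(lowVertices G D)) * (D + 1) ≤ 2 * G.edgeSet.ncard := by
  rw [← coe_edgeFinset, Set.ncard_coe_finset, ← sum_degrees_eq_twice_card_edges,
    ← card_compl, ← smul_eq_mul]
  refine (card_nsmul_le_sum _ (fun v => G.degree v) _ ?_).trans
    (sum_le_sum_of_subset (subset_univ _))
  intro v hv
  simp only [lowVertices, mem_compl, mem_filter, mem_univ, true_and, not_le] at hv
  exact hv

/-- Jensen's inequality for `x ↦ 2 ^ (-x)`. -/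
lemma card_mul_logb_le_sum {ι : Type*} (s : Finset ι) (d : ι → ℕ) {K : ℝ} (hK : 0 < K)
    (h : ∑ i ∈ s, ((2 : ℝ) ^ d i)⁻¹ ≤ K) :
    #s * Real.logb 2 (#s / K) ≤ ∑ i ∈ s, (d i : ℝ) := by
  rcases s.eq_empty_or_nonempty with rfl | hs
  · simp
  have hm : (0 : ℝ) < #s := by exact_mod_cast hs.card_pos
  set t := Real.logb 2 (#s / K) with ht
  have hlog : 0 < Real.log 2 := Real.log_pos one_lt_two
  have hpt : ∀ i ∈ s, K / #s * (1 + (t - d i) * Real.log 2) ≤ ((2 : ℝ) ^ d i)⁻¹ := by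
    intro i _
    have h1 : Real.exp ((t - d i) * Real.log 2) = #s / K * ((2 : ℝ) ^ d i)⁻¹ := by
      rw [mul_comm, ← Real.rpow_def_of_pos two_pos, Real.rpow_sub two_pos, ht,
        Real.rpow_logb two_pos (by norm_num) (by positivity), Real.rpow_natCast, div_eq_mul_inv]
    calc _ ≤ K / #s * (#s / K * ((2 : ℝ) ^ d i)⁻¹) := by
          rw [← h1]
          gcongr
          linarith [Real.add_one_le_exp ((t - d i) * Real.log 2)]
      _ = _ := by field_simp
  have hsum := (sum_le_sum hpt).trans h
  rw [← mul_sum, sum_add_distrib, ← sum_mul, sum_sub_distrib] at hsum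
  simp only [sum_const, nsmul_eq_mul, mul_one] at hsum
  rw [div_mul_eq_mul_div, div_le_iff₀ hm] at hsum
  have h2 := le_of_mul_le_mul_left hsum hK
  have h3 : (#s * t - ∑ i ∈ s, (d i : ℝ)) * Real.log 2 ≤ 0 := by linarith
  have h4 := nonpos_of_mul_nonpos_left h3 hlog
  linarith

lemma card_lowVertices_mul_logb_le {G : SimpleGraph V} {c : Sym2 V → Fin 2}
    (hc : IsRainbowEdgeColoring G c) (D : ℕ) :
    #(lowVertices G D) * Real.logb 2 (#(lowVertices G D) / (1 + D + D * D)) ≤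
      G.edgeSet.ncard := by
  refine (card_mul_logb_le_sum _ (fun v => #(highNeighbors G D v)) (by positivity)
    (sum_two_pow_highNeighbors_le hc D)).trans ?_
  exact_mod_cast sum_card_highNeighbors_le G D

end LowerBound

/-- The lower bound on `e2 n / (n * L)` in terms of `L = log₂ n`. -/
noncomputable def ratioLowerBound (L : ℝ) : ℝ :=
  min 1 ((1 - 2 / L) * (1 - Real.logb 2 (6 * L ^ 4) / L))

lemma tendsto_logb_pow_div : Filter.Tendsto (fun L : ℝ => Real.logb 2 (6 * L ^ 4) / L)
    Filter.atTop (nhds 0) := by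
  have h1 : Filter.Tendsto (fun L : ℝ => Real.log L / L) Filter.atTop (nhds 0) :=
    Real.isLittleO_log_id_atTop.tendsto_div_nhds_zero
  have h2 : Filter.Tendsto (fun L : ℝ => Real.log 6 / L) Filter.atTop (nhds 0) :=
    tendsto_const_nhds.div_atTop Filter.tendsto_id
  have h3 := (h2.add (h1.const_mul 4)).div_const (Real.log 2)
  simp only [mul_zero, add_zero, zero_div] at h3
  refine h3.congr' ?_
  filter_upwards [Filter.eventually_gt_atTop 0] with L hL
  rw [Real.logb, Real.log_mul (by norm_num) (by positivity), Real.log_pow]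
  push_cast
  ring

lemma tendsto_ratioLowerBound : Filter.Tendsto ratioLowerBound Filter.atTop (nhds 1) := by
  have h1 : Filter.Tendsto (fun L : ℝ => 2 / L) Filter.atTop (nhds 0) :=
    tendsto_const_nhds.div_atTop Filter.tendsto_id
  have h2 := (tendsto_const_nhds (x := (1 : ℝ))).min
    ((h1.const_sub 1).mul (tendsto_logb_pow_div.const_sub 1))
  unfold ratioLowerBound
  simpa using h2

lemma ratioLowerBound_mul_le {n : ℕ} (hn : 4 ≤ n) (hL : 4 ≤ Real.logb 2 n)
    (hs : Real.logb 2 (6 * Real.logb 2 n ^ 4) / Real.logb 2 n ≤ 1) :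
    ratioLowerBound (Real.logb 2 n) * (n * Real.logb 2 n) ≤ e2 n := by
  obtain ⟨G, c, hc, he⟩ := exists_isRainbowEdgeColoring_ncard_eq_e2 hn
  set L := Real.logb 2 n with hLdef
  have hn0 : (0 : ℝ) < n := by positivity
  have hL0 : 0 < L := by linarith
  rcases le_total (n * L) (e2 n) with hbig | hsmall
  · calc _ ≤ 1 * (n * L) := by gcongr; exact min_le_left _ _
      _ ≤ _ := by linarith
  set D := ⌊L ^ 2⌋₊ with hD
  set m := (lowVertices G D).card with hm
  have hDle : (D : ℝ) ≤ L ^ 2 := Nat.floor_le (by positivity)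
  have hDlt : L ^ 2 < D + 1 := Nat.lt_floor_add_one _
  have hlow := card_lowVertices_mul_logb_le hc D
  have hhigh := card_high_mul_le G D
  rw [he, ← hm] at hlow hhigh
  rw [Fintype.card_fin] at hhigh
  have hmn : m ≤ n := by simpa using (lowVertices G D).card_le_univ
  have hhigh' : ((n : ℝ) - m) * (D + 1) ≤ 2 * e2 n := by
    rw [← Nat.cast_sub hmn]; exact_mod_cast hhigh
  have hmlarge : n * (1 - 2 / L) ≤ m := by
    have h1 : ((n : ℝ) - m) * L ^ 2 ≤ 2 * (n * L) := by
      have : (0 : ℝ) ≤ n - m := sub_nonneg.2 (by exact_mod_cast hmn)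
      nlinarith
    have h2 : ((n : ℝ) - m) * L ≤ 2 * n := by
      refine le_of_mul_le_mul_right ?_ hL0
      linarith
    have h3 : (n : ℝ) - m ≤ 2 * n / L := by rwa [le_div_iff₀ hL0]
    calc n * (1 - 2 / L) = n - 2 * n / L := by ring
      _ ≤ m := by linarith
  have hhalf : 2 / L ≤ 1 / 2 := by rw [div_le_iff₀ hL0]; linarith
  have hmhalf : n / 2 ≤ (m : ℝ) := by nlinarith
  have hK : (1 + D + D * D : ℝ) ≤ 3 * L ^ 4 := by
    have h1 : (1 : ℝ) ≤ L ^ 2 := by nlinarith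
    have h2 : (0 : ℝ) ≤ D := by positivity
    have h3 : (D : ℝ) * D ≤ L ^ 2 * L ^ 2 := by gcongr
    nlinarith
  have hlogb : L - Real.logb 2 (6 * L ^ 4) ≤ Real.logb 2 (m / (1 + D + D * D)) := by
    rw [hLdef, ← Real.logb_div (by positivity) (by positivity), ← hLdef]
    refine Real.logb_le_logb_of_le one_lt_two (by positivity) ?_
    calc (n : ℝ) / (6 * L ^ 4) = n / 2 / (3 * L ^ 4) := by rw [div_div]; ring_nf
      _ ≤ (m : ℝ) / (1 + D + D * D) := by gcongr
  have hs0 : 0 ≤ L - Real.logb 2 (6 * L ^ 4) := by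
    rw [div_le_one hL0] at hs
    linarith
  calc _ ≤ ((1 - 2 / L) * (1 - Real.logb 2 (6 * L ^ 4) / L)) * (n * L) := by
        gcongr; exact min_le_right _ _
    _ = n * (1 - 2 / L) * (L - Real.logb 2 (6 * L ^ 4)) := by field_simp
    _ ≤ m * Real.logb 2 (m / (1 + D + D * D)) := by gcongr
    _ ≤ e2 n := hlow

lemma clog_two_le {n : ℕ} (hn : 2 ≤ n) : (Nat.clog 2 n : ℝ) ≤ Real.logb 2 n + 1 := by
  have h := Nat.pow_pred_clog_lt_self one_lt_two (show 1 < n by lia)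
  have hpos : 0 < Nat.clog 2 n := Nat.clog_pos one_lt_two hn
  have h2 : ((Nat.clog 2 n).pred : ℝ) ≤ Real.logb 2 n := by
    rw [Real.le_logb_iff_rpow_le one_lt_two (by positivity), Real.rpow_natCast]
    exact_mod_cast h.le
  have h3 : ((Nat.clog 2 n).pred : ℝ) + 1 = Nat.clog 2 n := by
    exact_mod_cast Nat.succ_pred_eq_of_pos hpos
  linarith

theorem e2_asymptotic :
    Filter.Tendsto (fun n : ℕ => (e2 n : ℝ) / (n * Real.logb 2 n))
      Filter.atTop (nhds 1) := by
  have hL : Filter.Tendsto (fun n : ℕ => Real.logb 2 n) Filter.atTop Filter.atTop :=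
    (Real.tendsto_logb_atTop one_lt_two).comp tendsto_natCast_atTop_atTop
  have hupper : Filter.Tendsto (fun n : ℕ => 1 + 1 / Real.logb 2 n) Filter.atTop (nhds 1) := by
    simpa using (tendsto_const_nhds (x := (1 : ℝ))).add
      ((tendsto_const_nhds (x := (1 : ℝ))).div_atTop hL)
  refine tendsto_of_tendsto_of_tendsto_of_le_of_le' (tendsto_ratioLowerBound.comp hL) hupper ?_ ?_
  · filter_upwards [Filter.eventually_ge_atTop 4, hL.eventually_ge_atTop 4,
      hL.eventually (tendsto_logb_pow_div.eventually_le_const one_pos)] with n hn h4 h1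
    rw [le_div_iff₀ (by positivity)]
    exact ratioLowerBound_mul_le hn h4 h1
  · filter_upwards [Filter.eventually_ge_atTop 4, hL.eventually_ge_atTop 4] with n hn h4
    have hpos : 0 < Real.logb 2 n := by linarith
    rw [div_le_iff₀ (by positivity)]
    calc (e2 n : ℝ) ≤ n * Nat.clog 2 n := by exact_mod_cast e2_le hn
      _ ≤ n * (Real.logb 2 n + 1) := by gcongr; exact clog_two_le (by lia)
      _ = (1 + 1 / Real.logb 2 n) * (n * Real.logb 2 n) := by field_simp
end

section
/- Let $d \ge 2$ be an integer and let $n > d$ be such that some graph of order $n$ has rainbow vertex connection number $d$. Then $e'_d(n) = n - 1$, i.e., the minimum number of edges of a graph of order $n$ with rainbow vertex connection number $d$ equals $n - 1$. -/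
open SimpleGraph

/-- A vertex-coloring `c` of `G` is rainbow (for vertex connectivity) if every two
distinct vertices are joined by a path whose internal vertices receive pairwise
distinct colors. -/
def IsRainbowVertexColoring {V : Type*} (G : SimpleGraph V) {α : Type*} (c : V → α) : Prop :=
  ∀ u v : V, u ≠ v → ∃ p : G.Walk u v, p.IsPath ∧ (p.support.tail.dropLast.map c).Nodup

/-- The rainbow vertex connection number of `G`: the least `k` admitting a
`k`-rainbow vertex-coloring. -/
noncomputable def rvcNum {V : Type*} (G : SimpleGraph V) : ℕ :=
  sInf {k | ∃ c : V → Fin k, IsRainbowVertexColoring G c}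

theorem SimpleGraph.Walk.IsPath.mem_support_tail_dropLast_iff {V : Type*} {G : SimpleGraph V}
    {u v x : V} {p : G.Walk u v} (hp : p.IsPath) :
    x ∈ p.support.tail.dropLast ↔ x ∈ p.support ∧ x ≠ u ∧ x ≠ v := by
  have hnd := hp.support_nodup
  cases p with
  | nil => simp
  | cons h q =>
    have hq := q.dropLast_support_concat
    simp only [Walk.support_cons, List.tail_cons] at hnd ⊢
    generalize q.support.dropLast = l at hq ⊢
    rw [← hq] at hnd ⊢
    grind

/-- A coloring of a connected graph that is injective outside a set of leaves is rainbow. -/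
theorem SimpleGraph.Connected.isRainbowVertexColoring {V α : Type*} {G : SimpleGraph V}
    (hG : G.Connected) {L : Set V} (hL : ∀ x ∈ L, (G.neighborSet x).Subsingleton)
    {c : V → α} (hc : Set.InjOn c Lᶜ) : IsRainbowVertexColoring G c := by
  intro u v _
  obtain ⟨p, hp⟩ := hG.exists_isPath u v
  refine ⟨p, hp, List.Nodup.map_on ?_ ?_⟩
  · have key : ∀ x ∈ p.support.tail.dropLast, x ∈ Lᶜ := by
      intro x hx hxL
      obtain ⟨hxp, hxu, hxv⟩ := hp.mem_support_tail_dropLast_iff.mp hx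
      exact hp.isTrail.not_mem_support_of_subsingleton_neighborSet hxu hxv (hL x hxL) hxp
    exact fun x hx y hy hxy => hc (key x hx) (key y hy) hxy
  · exact hp.support_nodup.sublist ((List.dropLast_sublist _).trans (List.tail_sublist _))

theorem IsRainbowVertexColoring.mono {V α : Type*} {G H : SimpleGraph V} (hle : G ≤ H)
    {c : V → α} (hc : IsRainbowVertexColoring G c) : IsRainbowVertexColoring H c := by
  intro u v huv
  obtain ⟨p, hp, hpc⟩ := hc u v huv
  exact ⟨p.mapLe hle, hp.mapLe hle, by rwa [Walk.support_mapLe_eq_support]⟩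

theorem IsRainbowVertexColoring.preconnected {V α : Type*} {G : SimpleGraph V}
    {c : V → α} (hc : IsRainbowVertexColoring G c) : G.Preconnected := by
  intro u v
  by_cases huv : u = v
  · exact huv ▸ Reachable.refl _
  · exact ⟨(hc u v huv).choose⟩

theorem IsRainbowVertexColoring.rvcNum_le {V : Type*} {G : SimpleGraph V} {k : ℕ}
    {c : V → Fin k} (hc : IsRainbowVertexColoring G c) : rvcNum G ≤ k :=
  Nat.sInf_le ⟨c, hc⟩

theorem exists_isRainbowVertexColoring_of_rvcNum_ne_zero {V : Type*} {G : SimpleGraph V}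
    (h : rvcNum G ≠ 0) : ∃ c : V → Fin (rvcNum G), IsRainbowVertexColoring G c :=
  Nat.sInf_mem (Nat.nonempty_of_sInf_eq_succ (Nat.succ_pred_eq_of_ne_zero h).symm)

theorem connected_of_rvcNum_ne_zero {V : Type*} [Nonempty V] {G : SimpleGraph V}
    (h : rvcNum G ≠ 0) : G.Connected :=
  ⟨(exists_isRainbowVertexColoring_of_rvcNum_ne_zero h).choose_spec.preconnected⟩

/-- A finite connected graph can be rainbow-colored without spending a color on two leaves of
a spanning tree. -/
theorem SimpleGraph.Connected.rvcNum_add_two_le_card {V : Type*} [Fintype V] {G : SimpleGraph V}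
    (hG : G.Connected) (hV : 3 ≤ Fintype.card V) : rvcNum G + 2 ≤ Fintype.card V := by
  classical
  have : Nontrivial V := Fintype.one_lt_card_iff_nontrivial.mp (by lia)
  obtain ⟨T, hle, hT⟩ := hG.exists_isTree_le
  obtain ⟨a, b, hab, ha, hb⟩ := hT.exists_ne_and_degree_eq_one
  have leaf : ∀ x, T.degree x = 1 → (T.neighborSet x).Subsingleton := fun x hx y hy z hz =>
    (degree_eq_one_iff_existsUnique_adj.mp hx).unique hy hz
  have hcard : (({a, b} : Set V)ᶜ).encard ≤
      (Set.univ : Set (Fin (Fintype.card V - 2))).encard := by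
    have h : ({a, b} : Set V)ᶜ = (({a, b} : Finset V)ᶜ : Finset V) := by
      rw [Finset.coe_compl, Finset.coe_pair]
    rw [h, Set.encard_coe_eq_coe_finsetCard, Finset.card_compl, Finset.card_pair hab]
    simp
  have : Nonempty (Fin (Fintype.card V - 2)) := ⟨⟨0, by lia⟩⟩
  obtain ⟨c, -, hc⟩ := Set.Finite.exists_injOn_of_encard_le (Set.toFinite _) hcard
  have hrb : IsRainbowVertexColoring T c := by
    refine hT.connected.isRainbowVertexColoring (L := {a, b}) ?_ hc
    rintro x (rfl | rfl)
    exacts [leaf _ ha, leaf _ hb]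
  have := (hrb.mono hle).rvcNum_le
  lia

/-- The broom: the path `0, 1, …, d` with the vertices `d + 1, …, n - 1` attached to `d`. -/
def broom (d n : ℕ) : SimpleGraph (Fin n) where
  Adj i j := (0 < j.val ∧ i.val = min (j.val - 1) d) ∨ (0 < i.val ∧ j.val = min (i.val - 1) d)
  symm := ⟨fun _ _ h => h.symm⟩
  loopless := ⟨fun i h => by lia⟩

theorem broom_adj {d n : ℕ} {i j : Fin n} : (broom d n).Adj i j ↔
    (0 < j.val ∧ i.val = min (j.val - 1) d) ∨ (0 < i.val ∧ j.val = min (i.val - 1) d) :=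
  Iff.rfl

theorem broom_connected {d n : ℕ} (hn : 0 < n) : (broom d n).Connected := by
  have key : ∀ m (hm : m < n), (broom d n).Reachable ⟨m, hm⟩ ⟨0, hn⟩ := by
    intro m
    induction m using Nat.strong_induction_on with
    | _ m ih =>
      intro hm
      obtain rfl | hpos := Nat.eq_zero_or_pos m
      · rfl
      · have hlt : min (m - 1) d < m := by lia
        refine Reachable.trans (Adj.reachable ?_) (ih _ hlt (hlt.trans hm))
        exact broom_adj.mpr (Or.inr ⟨hpos, rfl⟩)
  have : Nonempty (Fin n) := ⟨⟨0, hn⟩⟩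
  exact ⟨fun u v => (key u u.2).trans (key v v.2).symm⟩

theorem broom_ncard_edgeSet_le (d n : ℕ) : (broom d n).edgeSet.ncard ≤ n - 1 := by
  obtain _ | n := n
  · simp [Set.eq_empty_of_isEmpty]
  let f : Fin n → Sym2 (Fin (n + 1)) := fun i => s(⟨min i.val d, by lia⟩, i.succ)
  have hsub : (broom d (n + 1)).edgeSet ⊆ Set.range f := by
    have key : ∀ i j : Fin (n + 1), 0 < j.val → i.val = min (j.val - 1) d →
        s(i, j) ∈ Set.range f := by
      intro i j hj hi
      refine ⟨⟨j.val - 1, by lia⟩, ?_⟩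
      have h1 : (⟨min (j.val - 1) d, by lia⟩ : Fin (n + 1)) = i := Fin.ext hi.symm
      have h2 : (⟨j.val - 1, by lia⟩ : Fin n).succ = j := Fin.ext (by simp; lia)
      simp only [f, h1, h2]
    intro e
    induction e with
    | _ i j =>
      rw [mem_edgeSet, broom_adj]
      rintro (⟨hj, hi⟩ | ⟨hi, hj⟩)
      · exact key i j hj hi
      · exact Sym2.eq_swap ▸ key j i hi hj
  calc (broom d (n + 1)).edgeSet.ncard ≤ (Set.range f).ncard :=
        Set.ncard_le_ncard hsub (Set.toFinite _)
    _ ≤ n := by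
        rw [← Set.image_univ]
        exact (Set.ncard_image_le Set.finite_univ).trans (by simp)
    _ = n + 1 - 1 := rfl

theorem mem_support_of_broom_walk {d n : ℕ} {i u v : Fin n} (hi : i.val ≤ d)
    (p : (broom d n).Walk u v) (hu : u ≤ i) (hv : i ≤ v) : i ∈ p.support := by
  induction p with
  | nil => simpa using le_antisymm hv hu
  | @cons u w v h q ih =>
    rw [Walk.support_cons, List.mem_cons]
    by_cases hui : i = u
    · exact Or.inl hui
    · refine Or.inr (ih ?_ hv)
      rw [broom_adj] at h
      lia

theorem rvcNum_broom {d n : ℕ} (hd : 0 < d) (hn : d + 2 ≤ n) : rvcNum (broom d n) = d := by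
  refine le_antisymm ?_ ?_
  · let c : Fin n → Fin d := fun i => ⟨i.val % d, Nat.mod_lt _ hd⟩
    refine IsRainbowVertexColoring.rvcNum_le (c := c)
      ((broom_connected (by lia)).isRainbowVertexColoring (L := {i | i.val = 0 ∨ d < i.val}) ?_ ?_)
    · intro x hx y hy z hz
      simp only [mem_neighborSet, broom_adj, Set.mem_ofPred_eq] at hx hy hz
      lia
    · intro x hx y hy hxy
      simp only [Set.mem_compl_iff, Set.mem_ofPred_eq, not_or, not_lt] at hx hy
      have hmod : x.val ≡ y.val [MOD d] := congrArg Fin.val hxy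
      have hsub : x.val - 1 ≡ y.val - 1 [MOD d] :=
        Nat.ModEq.add_right_cancel' 1 (by
          rwa [Nat.sub_add_cancel (by lia), Nat.sub_add_cancel (by lia)])
      have := hsub.eq_of_lt_of_lt (by lia) (by lia)
      lia
  · refine le_csInf ⟨n, id, ?_⟩ ?_
    · exact (broom_connected (by lia)).isRainbowVertexColoring (L := ∅) (by simp)
        Function.injective_id.injOn
    · rintro k ⟨c, hc⟩
      obtain ⟨p, hp, hpc⟩ := hc ⟨0, by lia⟩ ⟨d + 1, by lia⟩ (by simp)
      have hmem : ∀ i : Fin d, (⟨i.val + 1, by lia⟩ : Fin n) ∈ p.support.tail.dropLast := by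
        intro i
        refine hp.mem_support_tail_dropLast_iff.mpr
          ⟨mem_support_of_broom_walk i.2 p ?_ ?_, ?_, ?_⟩ <;>
          simp only [Fin.le_def, ne_eq, Fin.mk.injEq] <;> lia
      have hinj : Function.Injective fun i : Fin d => c ⟨i.val + 1, by lia⟩ := by
        intro i j hij
        have := List.inj_on_of_nodup_map hpc (hmem i) (hmem j) hij
        simpa [Fin.ext_iff] using this
      simpa using Fintype.card_le_of_injective _ hinj

theorem e'd_eq (d n : ℕ) (hd : 2 ≤ d) (hn : d < n)
    (h : ∃ G : SimpleGraph (Fin n), rvcNum G = d) :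
    sInf {m | ∃ G : SimpleGraph (Fin n), rvcNum G = d ∧ G.edgeSet.ncard = m} = n - 1 := by
  have : Nonempty (Fin n) := ⟨⟨0, by lia⟩⟩
  have hn2 : d + 2 ≤ n := by
    obtain ⟨G, hG⟩ := h
    have := (connected_of_rvcNum_ne_zero (by lia : rvcNum G ≠ 0)).rvcNum_add_two_le_card
    simp only [Fintype.card_fin] at this
    lia
  have hbroom := rvcNum_broom (by lia) hn2
  refine le_antisymm ?_ ?_
  · exact le_trans (Nat.sInf_le ⟨broom d n, hbroom, rfl⟩) (broom_ncard_edgeSet_le d n)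
  · refine le_csInf ⟨_, broom d n, hbroom, rfl⟩ ?_
    rintro m ⟨G, hG, rfl⟩
    have hG0 : rvcNum G ≠ 0 := by lia
    have := (connected_of_rvcNum_ne_zero hG0).card_vert_le_card_edgeSet_add_one
    rw [Nat.card_coe_set_eq, Nat.card_fin] at this
    lia
end

section
/- Let $d \ge 2$ be an integer and let $G$ be a connected graph of order $n$ with rainbow vertex connection number $rvc(G) = d$. Then $G$ has exactly $n - 1$ edges if and only if deleting all leaves (vertices of degree $1$) of $G$ results in a tree of order $d$. -/
open SimpleGraph

namespace SimpleGraph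

variable {V : Type*} {G : SimpleGraph V}

lemma degree_ne_one_of_adj_of_adj {v a b : V} [Fintype (G.neighborSet v)]
    (ha : G.Adj v a) (hb : G.Adj v b) (hab : a ≠ b) : G.degree v ≠ 1 := fun h =>
  hab ((degree_eq_one_iff_existsUnique_adj.mp h).unique ha hb)

lemma exists_adj_ne_of_degree_ne_one {v a : V} [Fintype (G.neighborSet v)]
    (h : G.degree v ≠ 1) (ha : G.Adj v a) : ∃ b, G.Adj v b ∧ b ≠ a := by
  by_contra! hc
  exact h (degree_eq_one_iff_existsUnique_adj.mpr ⟨a, ha, hc⟩)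

/-- The internal vertices of a path are not leaves. -/
lemma Walk.IsPath.degree_ne_one_of_mem_tail_dropLast [G.LocallyFinite] {u v w : V}
    {p : G.Walk u v} (hp : p.IsPath) (hw : w ∈ p.support.tail.dropLast) : G.degree w ≠ 1 := by
  obtain ⟨i, hi, rfl⟩ := List.getElem_of_mem hw
  have hi' : i + 2 ≤ p.length := by
    simp only [List.length_dropLast, List.length_tail, Walk.length_support] at hi
    omega
  have hget : p.support.tail.dropLast[i] = p.getVert (i + 1) := by
    simp [Walk.getVert_eq_support_getElem p (show i + 1 ≤ p.length by omega)]
  rw [hget]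
  refine degree_ne_one_of_adj_of_adj (p.adj_getVert_succ (show i < p.length by omega)).symm
    (p.adj_getVert_succ (show i + 1 < p.length by omega)) fun h => ?_
  have := hp.getVert_injOn (show i ≤ p.length by omega) (show i + 1 + 1 ≤ p.length by omega) h
  omega

/-- No vertex of a cycle is a leaf. -/
lemma Walk.IsCycle.degree_ne_one_of_mem_support [G.LocallyFinite] {u w : V} {p : G.Walk u u}
    (hp : p.IsCycle) (hw : w ∈ p.support) : G.degree w ≠ 1 := by
  classical
  have hr := hp.rotate hw
  exact degree_ne_one_of_adj_of_adj (Walk.adj_snd hr.not_nil)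
    (Walk.adj_penultimate hr.not_nil).symm hr.snd_ne_penultimate

lemma IsAcyclic.of_induce_degree_ne_one [G.LocallyFinite]
    (h : (G.induce {v | G.degree v ≠ 1}).IsAcyclic) : G.IsAcyclic := by
  intro u p hp
  refine h (p.induce {v | G.degree v ≠ 1} fun x hx => hp.degree_ne_one_of_mem_support hx)
    (.of_map (f := (Embedding.induce _).toHom) ?_)
  rwa [Walk.map_induce]

lemma Connected.isTree_iff_isTree_induce_degree_ne_one [G.LocallyFinite] (hG : G.Connected)
    (hne : {v | G.degree v ≠ 1}.Nonempty) :
    G.IsTree ↔ (G.induce {v | G.degree v ≠ 1}).IsTree := by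
  have := hne.to_subtype
  refine ⟨fun h => ⟨⟨hG.preconnected.induce_of_degree_eq_one fun v hv a ha b hb => ?_⟩,
    h.isAcyclic.induce _⟩, fun h => ⟨hG, .of_induce_degree_ne_one h.isAcyclic⟩⟩
  by_contra hab
  exact hv (degree_ne_one_of_adj_of_adj ha hb hab)

end SimpleGraph

section

variable {V : Type*} {G : SimpleGraph V}

lemma IsRainbowVertexColoring.of_injOn_degree_ne_one [G.LocallyFinite] {α : Type*}
    (hG : G.Connected) {c : V → α} (hc : Set.InjOn c {v | G.degree v ≠ 1}) :
    IsRainbowVertexColoring G c := by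
  intro u v _
  obtain ⟨p, hp⟩ := hG.exists_isPath u v
  refine ⟨p, hp, List.Nodup.map_on (fun x hx y hy h => hc ?_ ?_ h) ?_⟩
  · exact hp.degree_ne_one_of_mem_tail_dropLast hx
  · exact hp.degree_ne_one_of_mem_tail_dropLast hy
  · exact hp.support_nodup.sublist
      ((List.dropLast_sublist _).trans (List.tail_sublist _))

lemma IsRainbowVertexColoring.injOn_degree_ne_one [G.LocallyFinite] {α : Type*} {c : V → α}
    (hc : IsRainbowVertexColoring G c) (hG : G.IsTree) : Set.InjOn c {v | G.degree v ≠ 1} := by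
  intro u hu v hv huv
  by_contra hne
  obtain ⟨q, hq⟩ := hG.connected.exists_isPath u v
  have hnil : ¬ q.Nil := Walk.not_nil_of_ne hne
  obtain ⟨u', hu', hus⟩ := exists_adj_ne_of_degree_ne_one hu (Walk.adj_snd hnil)
  obtain ⟨v', hv', hvp⟩ := exists_adj_ne_of_degree_ne_one hv (Walk.adj_penultimate hnil).symm
  have hr : (Walk.cons hu'.symm q).IsPath :=
    hq.cons fun h => hus (hG.isAcyclic.eq_snd_of_adj_start hq hu' h)
  have hv'r : v' ∉ (Walk.cons hu'.symm q).support := fun h => hvp <| by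
    rw [hG.isAcyclic.eq_penultimate_of_adj_end hr hv' h,
      Walk.penultimate_cons_of_not_nil _ _ hnil]
  obtain ⟨p, hp, hnd⟩ := hc u' v' fun h => hv'r (h ▸ Walk.start_mem_support _)
  rw [(hG.existsUnique_path u' v').unique hp (hr.concat hv'r hv')] at hnd
  simp only [Walk.support_concat, Walk.support_cons, List.cons_append, List.tail_cons,
    List.dropLast_concat] at hnd
  exact hne (List.inj_on_of_nodup_map hnd q.start_mem_support q.end_mem_support huv)

lemma rvcNum_le_max_one_card [Finite V] [G.LocallyFinite] (hG : G.Connected) :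
    rvcNum G ≤ max 1 (Nat.card {v | G.degree v ≠ 1}) := by
  have : NeZero (max 1 (Nat.card {v | G.degree v ≠ 1})) := ⟨by omega⟩
  let f : {v | G.degree v ≠ 1} ↪ Fin (max 1 (Nat.card {v | G.degree v ≠ 1})) :=
    (Finite.equivFin _).toEmbedding.trans (Fin.castLEEmb (le_max_right _ _))
  refine Nat.sInf_le ⟨Function.extend Subtype.val f fun _ => 0,
    .of_injOn_degree_ne_one hG fun x hx y hy h => ?_⟩
  have hext := Subtype.val_injective.extend_apply f fun _ => 0
  have := (hext ⟨x, hx⟩).symm.trans (h.trans (hext ⟨y, hy⟩))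
  exact congrArg Subtype.val (f.injective this)

lemma exists_isRainbowVertexColoring_rvcNum [Finite V] (hG : G.Connected) :
    ∃ c : V → Fin (rvcNum G), IsRainbowVertexColoring G c := by
  have := Fintype.ofFinite V
  classical
  exact Nat.sInf_mem (s := {k | ∃ c : V → Fin k, IsRainbowVertexColoring G c})
    ⟨Nat.card V, Finite.equivFin V, .of_injOn_degree_ne_one hG (Finite.equivFin V).injective.injOn⟩

lemma SimpleGraph.IsTree.card_degree_ne_one_le_rvcNum [Finite V] [G.LocallyFinite]
    (hG : G.IsTree) : Nat.card {v | G.degree v ≠ 1} ≤ rvcNum G := by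
  obtain ⟨c, hc⟩ := exists_isRainbowVertexColoring_rvcNum hG.connected
  simpa using Nat.card_le_card_of_injective _ (hc.injOn_degree_ne_one hG).injective

end

theorem minimal_rvc_graph_characterization {V : Type*} [Fintype V] [DecidableEq V]
    (G : SimpleGraph V) [DecidableRel G.Adj] (d : ℕ) (hd : 2 ≤ d)
    (hG : G.Connected) (hrvc : rvcNum G = d) :
    G.edgeSet.ncard = Fintype.card V - 1 ↔
      (G.induce {v | G.degree v ≠ 1}).IsTree ∧ Nat.card {v : V | G.degree v ≠ 1} = d := by
  have htree : G.edgeSet.ncard = Fintype.card V - 1 ↔ G.IsTree := by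
    have := hG.nonempty
    have := Fintype.card_pos (α := V)
    rw [isTree_iff_connected_and_card, and_iff_right hG, Nat.card_coe_set_eq,
      Nat.card_eq_fintype_card]
    omega
  have hle : d ≤ Nat.card {v | G.degree v ≠ 1} := by
    have := rvcNum_le_max_one_card hG
    omega
  have hne : {v | G.degree v ≠ 1}.Nonempty :=
    Set.nonempty_coe_sort.mp (Nat.card_pos_iff.mp (by omega)).1
  rw [htree, hG.isTree_iff_isTree_induce_degree_ne_one hne]
  refine ⟨fun h => ⟨h, le_antisymm ?_ hle⟩, And.left⟩
  rw [← hrvc]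
  exact ((hG.isTree_iff_isTree_induce_degree_ne_one hne).mpr h).card_degree_ne_one_le_rvcNum
end

section
/- Let $k \ge 2$ and $n$ be integers with $k + 2^{k-1} \le n \le k + 2^k$. Then the complete bipartite graph $K_{k, n-k}$ has rainbow connection number $rc(K_{k,n-k}) = 2$. -/
open SimpleGraph

/-- The edge-coloring of `completeBipartiteGraph α β` given by a matrix of colors. -/
def bipartiteColoring {α β γ : Type*} (d : γ) (f : β → α → γ) : Sym2 (α ⊕ β) → γ :=
  Sym2.lift ⟨fun x y => match x, y with
    | .inl i, .inr j => f j i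
    | .inr j, .inl i => f j i
    | _, _ => d, by rintro (i | i) (j | j) <;> rfl⟩

lemma exists_rainbow_path_of_adj {V α : Type*} {G : SimpleGraph V} (c : Sym2 V → α) {u v : V}
    (h : G.Adj u v) : ∃ p : G.Walk u v, p.IsPath ∧ (p.edges.map c).Nodup :=
  ⟨h.toWalk, by simp [h.ne], by simp⟩

lemma exists_rainbow_path_of_adj_adj {V α : Type*} {G : SimpleGraph V} (c : Sym2 V → α)
    {u v w : V} (huw : u ≠ w) (h : G.Adj u v) (h' : G.Adj v w) (hc : c s(u, v) ≠ c s(v, w)) :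
    ∃ p : G.Walk u w, p.IsPath ∧ (p.edges.map c).Nodup :=
  ⟨.cons h h'.toWalk, by simp [h.ne, h'.ne, huw], by simpa using hc⟩

/-- A matrix of colors with pairwise distinct rows and pairwise distinct columns gives a rainbow
coloring of the complete bipartite graph. -/
lemma isRainbowEdgeColoring_bipartiteColoring {α β γ : Type*} (d : γ) (f : β → α → γ)
    (hrow : Function.Injective f) (hcol : ∀ i i', i ≠ i' → ∃ j, f j i ≠ f j i') :
    IsRainbowEdgeColoring (completeBipartiteGraph α β) (bipartiteColoring d f) := by
  rintro (i | j) (i' | j') huv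
  · obtain ⟨j, hj⟩ := hcol i i' (by simpa using huv)
    exact exists_rainbow_path_of_adj_adj _ (v := Sum.inr j) huv (by simp) (by simp) hj
  · exact exists_rainbow_path_of_adj _ (by simp)
  · exact exists_rainbow_path_of_adj _ (by simp)
  · obtain ⟨i, hi⟩ := Function.ne_iff.mp (hrow.ne (a₁ := j) (a₂ := j') (by simpa using huv))
    exact exists_rainbow_path_of_adj_adj _ (v := Sum.inl i) huv (by simp) (by simp) hi

/-- Two distinct nonadjacent vertices force at least two colors. -/
lemma two_le_of_isRainbowEdgeColoring {V : Type*} {G : SimpleGraph V} {m : ℕ} {c : Sym2 V → Fin m}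
    (hc : IsRainbowEdgeColoring G c) {u v : V} (huv : u ≠ v) (hadj : ¬ G.Adj u v) : 2 ≤ m := by
  obtain ⟨p, -, hp⟩ := hc u v huv
  have hlen : p.length ≤ m := by simpa using hp.length_le_card
  have h0 : p.length ≠ 0 := fun h => huv (Walk.eq_of_length_eq_zero h)
  have h1 : p.length ≠ 1 := fun h => hadj (Walk.adj_of_length_eq_one h)
  omega

/-- There are `t` distinct binary vectors of length `k` separating all coordinates whenever
`k ≤ t ≤ 2 ^ k`. -/
lemma exists_injective_separating {k t : ℕ} (hkt : k ≤ t) (ht : t ≤ 2 ^ k) :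
    ∃ f : Fin t → Fin k → Fin 2, Function.Injective f ∧
      ∀ i i', i ≠ i' → ∃ j, f j i ≠ f j i' := by
  let e : Fin k → Fin k → Fin 2 := fun i => Pi.single i 1
  have hcard : (Finset.univ.image e).card ≤ t :=
    Finset.card_image_le.trans (by simpa using hkt)
  obtain ⟨S, heS, -, hS⟩ := Finset.exists_subsuperset_card_eq
    (Finset.subset_univ (Finset.univ.image e)) hcard (by simpa using ht)
  let g := (S.equivFinOfCardEq hS).symm
  refine ⟨fun j => g j, Subtype.val_injective.comp g.injective, fun i i' hii' => ?_⟩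
  have hi : e i ∈ S := heS (Finset.mem_image_of_mem e (Finset.mem_univ i))
  exact ⟨g.symm ⟨e i, hi⟩, by simp [e, Pi.single_eq_of_ne hii'.symm]⟩

theorem rc_completeBipartite_eq_two (k n : ℕ) (hk : 2 ≤ k)
    (h1 : k + 2 ^ (k - 1) ≤ n) (h2 : n ≤ k + 2 ^ k) :
    rainbowConnNum (completeBipartiteGraph (Fin k) (Fin (n - k))) = 2 := by
  have hk' : k ≤ 2 ^ (k - 1) := by
    have := Nat.lt_two_pow_self (n := k - 1)
    omega
  obtain ⟨f, hrow, hcol⟩ := exists_injective_separating (k := k) (t := n - k) (by omega) (by omega)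
  have hmem : 2 ∈ {m | ∃ c : Sym2 (Fin k ⊕ Fin (n - k)) → Fin m,
      IsRainbowEdgeColoring (completeBipartiteGraph (Fin k) (Fin (n - k))) c} :=
    ⟨_, isRainbowEdgeColoring_bipartiteColoring 0 f hrow hcol⟩
  refine le_antisymm (Nat.sInf_le hmem) (le_csInf ⟨2, hmem⟩ ?_)
  rintro m ⟨c, hc⟩
  exact two_le_of_isRainbowEdgeColoring hc (u := .inl ⟨0, by omega⟩) (v := .inl ⟨1, by omega⟩)
    (by simp) (by simp)
end

section
/- For every $n \ge 2$ for which a graph of order $n$ with rainbow connection number $2$ exists, $e_2(n) \ge \min\{\frac{n}{2} \log_2 n,\; n \log_2 n - 4n\}$; that is, every graph $G$ of order $n$ with $rc(G) = 2$ has at least $\min\{\frac{n}{2} \log_2 n, n \log_2 n - 4n\}$ edges. -/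
open SimpleGraph

/-- A bit assignment `b` keeps `w` alive if it assigns to each neighbor `z` of `w` the color of
the edge `zw`. -/
def KeepsAlive {V : Type*} (G : SimpleGraph V) (c : Sym2 V → Bool) (b : V → Bool) (w : V) : Prop :=
  ∀ z, G.Adj z w → b z = c s(z, w)

/-- The graph on bit assignments in which `b` is joined to the assignments obtained by flipping
the bit of a vertex of `S` kept alive by `b`. -/
def flipGraph {V : Type*} [DecidableEq V] (G : SimpleGraph V) (c : Sym2 V → Bool) (S : Finset V) :
    SimpleGraph (V → Bool) where
  Adj b b' := ∃ w ∈ S, KeepsAlive G c b w ∧ b' = Function.update b w (!b w)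
  symm := ⟨by
    rintro b _ ⟨w, hw, hb, rfl⟩
    refine ⟨w, hw, fun z hz => ?_, by simp⟩
    rw [Function.update_of_ne hz.ne, hb z hz]⟩
  loopless := ⟨by
    rintro b ⟨w, -, -, h⟩
    simpa using congrFun h w⟩

section Flip

variable {V : Type*} [DecidableEq V] {G : SimpleGraph V} {c : Sym2 V → Bool} {S : Finset V}

lemma KeepsAlive.update_self {b : V → Bool} {w : V} (h : KeepsAlive G c b w) (i : Bool) :
    KeepsAlive G c (Function.update b w i) w := fun z hz => by
  rw [Function.update_of_ne hz.ne, h z hz]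

lemma flipGraph_walk_apply_eq {b b' : V → Bool} (p : (flipGraph G c S).Walk b b') (w : V)
    (h : ∀ a ∈ p.support, ¬ KeepsAlive G c a w) : ∀ a ∈ p.support, a w = b w := by
  induction p with
  | nil => simp
  | @cons x y z hxy q ih =>
    have hxy' := hxy
    obtain ⟨u, -, hu, rfl⟩ := hxy'
    have huw : w ≠ u := by
      rintro rfl
      exact h _ (Walk.start_mem_support _) hu
    intro a ha
    rw [Walk.support_cons, List.mem_cons] at ha
    rcases ha with rfl | ha
    · rfl
    · rw [ih (fun a ha => h a (by simp [ha])) a ha, Function.update_of_ne huw]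

lemma flipGraph_path_apply_eq
    (hS : ∀ x ∈ S, ∀ y ∈ S, x ≠ y →
      G.Adj x y ∨ ∃ z, G.Adj z x ∧ G.Adj z y ∧ c s(z, x) ≠ c s(z, y))
    {b₁ b' : V → Bool} (q : (flipGraph G c S).Walk b₁ b') :
    q.IsPath → ∀ w ∈ S, KeepsAlive G c b₁ w →
      Function.update b₁ w (!b₁ w) ∉ q.support → ∀ a ∈ q.support, a w = b₁ w := by
  induction q with
  | nil => simp
  | @cons x y z hxy q ih =>
    intro hp w hwS hw hnot
    have hxy' := hxy
    obtain ⟨u, huS, hu, rfl⟩ := hxy'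
    rw [Walk.cons_isPath_iff] at hp
    have huw : u ≠ w := by
      rintro rfl
      exact hnot (by simp)
    have hadj : G.Adj u w := by
      rcases hS u huS w hwS huw with h | ⟨z, hzu, hzw, hne⟩
      · exact h
      · exact absurd ((hu z hzu).symm.trans (hw z hzw)) hne
    have hq := ih hp.1 u huS (hu.update_self _) (by simpa using hp.2)
    have hdead : ∀ a ∈ q.support, ¬ KeepsAlive G c a w := by
      intro a ha hal
      have h1 := hq a ha
      rw [hal u hadj, Function.update_self, hw u hadj] at h1
      simp at h1
    intro a ha
    rw [Walk.support_cons, List.mem_cons] at ha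
    rcases ha with rfl | ha
    · rfl
    · rw [flipGraph_walk_apply_eq q w hdead a ha, Function.update_of_ne huw.symm]

lemma flipGraph_isAcyclic
    (hS : ∀ x ∈ S, ∀ y ∈ S, x ≠ y →
      G.Adj x y ∨ ∃ z, G.Adj z x ∧ G.Adj z y ∧ c s(z, x) ≠ c s(z, y)) :
    (flipGraph G c S).IsAcyclic := by
  intro b p hp
  cases p with
  | nil => exact hp.ne_nil rfl
  | @cons _ b₁ _ h q =>
    rw [Walk.cons_isCycle_iff] at hp
    obtain ⟨hq, hedge⟩ := hp
    cases q with
    | nil => exact h.ne rfl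
    | @cons _ b₂ _ h₂ r =>
      have h' := h
      obtain ⟨w, hwS, hw, rfl⟩ := h'
      have h₂' := h₂
      obtain ⟨u, huS, hu, rfl⟩ := h₂'
      rw [Walk.cons_isPath_iff] at hq
      have huw : u ≠ w := by
        rintro rfl
        exact hedge (by simp [Sym2.eq_swap])
      have := flipGraph_path_apply_eq hS r hq.1 u huS (hu.update_self _) (by simpa using hq.2)
        b r.end_mem_support
      simp [Function.update_of_ne huw] at this

lemma SimpleGraph.IsAcyclic.card_edgeFinset_le {W : Type*} [Fintype W] [Nonempty W]
    {H : SimpleGraph W} [Fintype H.edgeSet] (hH : H.IsAcyclic) :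
    H.edgeFinset.card ≤ Fintype.card W := by
  classical
  obtain ⟨T, hHT, -, hT⟩ :=
    (connected_top (V := W)).exists_isTree_le_of_le_of_isAcyclic le_top hH
  have := hT.card_edgeFinset
  have := Finset.card_le_card (edgeFinset_mono hHT)
  omega

open Classical in
lemma sum_card_keepsAlive_le [Fintype V]
    (hS : ∀ x ∈ S, ∀ y ∈ S, x ≠ y →
      G.Adj x y ∨ ∃ z, G.Adj z x ∧ G.Adj z y ∧ c s(z, x) ≠ c s(z, y)) :
    ∑ w ∈ S, (Finset.univ.filter fun b => KeepsAlive G c b w).card ≤ 2 * 2 ^ Fintype.card V := by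
  have hdeg : ∀ b, (S.filter fun w => KeepsAlive G c b w).card ≤ (flipGraph G c S).degree b := by
    intro b
    rw [← card_neighborFinset_eq_degree]
    refine Finset.card_le_card_of_injOn (fun w => Function.update b w (!b w)) ?_ ?_
    · intro w hw
      simp only [Finset.coe_filter, Set.mem_ofPred_eq] at hw
      simp only [Finset.mem_coe, mem_neighborFinset]
      exact ⟨w, hw.1, hw.2, rfl⟩
    · intro w _ w' _ h
      by_contra hne
      have := congrFun h w
      simp [Function.update_of_ne hne] at this
  calc ∑ w ∈ S, (Finset.univ.filter fun b => KeepsAlive G c b w).card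
      = ∑ b : V → Bool, (S.filter fun w => KeepsAlive G c b w).card := by
        simp only [Finset.card_filter]
        exact Finset.sum_comm
    _ ≤ ∑ b, (flipGraph G c S).degree b := Finset.sum_le_sum fun b _ => hdeg b
    _ = 2 * (flipGraph G c S).edgeFinset.card := sum_degrees_eq_twice_card_edges _
    _ ≤ 2 * 2 ^ Fintype.card V := by
        have := IsAcyclic.card_edgeFinset_le (flipGraph_isAcyclic hS)
        simpa using this

open Classical in
lemma card_keepsAlive [Fintype V] [DecidableRel G.Adj] (w : V) :
    ((Finset.univ.filter fun b => KeepsAlive G c b w).card : ℝ) =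
      2 ^ Fintype.card V * (1 / 2) ^ G.degree w := by
  have h : (Finset.univ.filter fun b => KeepsAlive G c b w) =
      Fintype.piFinset fun z => if G.Adj z w then {c s(z, w)} else Finset.univ := by
    ext b
    rw [Finset.mem_filter_univ, Fintype.mem_piFinset]
    refine forall_congr' fun z => ?_
    split_ifs with hz <;> simp [hz]
  have hd : G.degree w = (Finset.univ.filter fun z => G.Adj z w).card := by
    rw [← card_neighborFinset_eq_degree]
    congr 1
    ext z
    simp [G.adj_comm]
  have hp : (1 / 2 : ℝ) ^ (Finset.univ.filter fun z => G.Adj z w).card =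
      ∏ z, if G.Adj z w then 1 / 2 else 1 := by simp [Finset.prod_ite]
  rw [h, Fintype.card_piFinset, hd, hp, ← Finset.card_univ,
    ← Finset.prod_const, ← Finset.prod_mul_distrib]
  push_cast
  refine Finset.prod_congr rfl fun z _ => ?_
  split_ifs <;> simp

open Classical in
/-- If any two vertices of `S` are adjacent or joined by a rainbow path of length two, then the
sum of `2 ^ (-deg x)` over `S` is at most two. -/
theorem sum_half_pow_degree_le_two [Fintype V] [DecidableRel G.Adj]
    (hS : ∀ x ∈ S, ∀ y ∈ S, x ≠ y →
      G.Adj x y ∨ ∃ z, G.Adj z x ∧ G.Adj z y ∧ c s(z, x) ≠ c s(z, y)) :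
    ∑ x ∈ S, (1 / 2 : ℝ) ^ G.degree x ≤ 2 := by
  have h : ((∑ w ∈ S, (Finset.univ.filter fun b => KeepsAlive G c b w).card : ℕ) : ℝ) ≤
      (2 * 2 ^ Fintype.card V : ℕ) := Nat.cast_le.2 (sum_card_keepsAlive_le hS)
  push_cast at h
  simp only [card_keepsAlive] at h
  rw [← Finset.mul_sum, mul_comm 2] at h
  exact le_of_mul_le_mul_left h (by positivity)

end Flip

section LowDegreeVertex

variable {V : Type*} [Fintype V] [DecidableEq V] {G : SimpleGraph V} [DecidableRel G.Adj]
  {c : Sym2 V → Bool}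

variable (G) in
/-- The vertices different from `v` and not adjacent to `v`. -/
def nonNeighbors (v : V) : Finset V := Finset.univ.filter fun x => x ≠ v ∧ ¬ G.Adj x v

variable (G) in
/-- The graph obtained from `G` by keeping the edges between vertices not adjacent to `v`. -/
def farGraph (v : V) : SimpleGraph V where
  Adj x y := G.Adj x y ∧ x ∈ nonNeighbors G v ∧ y ∈ nonNeighbors G v
  symm := ⟨fun _ _ h => ⟨h.1.symm, h.2.2, h.2.1⟩⟩
  loopless := ⟨fun _ h => G.loopless.irrefl _ h.1⟩

lemma farGraph_adj {v x y : V} : (farGraph G v).Adj x y ↔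
    G.Adj x y ∧ (x ≠ v ∧ ¬ G.Adj x v) ∧ (y ≠ v ∧ ¬ G.Adj y v) := by
  simp [farGraph, nonNeighbors]

instance (v : V) : DecidableRel (farGraph G v).Adj := fun x y =>
  inferInstanceAs (Decidable (G.Adj x y ∧ x ∈ nonNeighbors G v ∧ y ∈ nonNeighbors G v))

variable (G c) in
/-- The common neighbors `u` of `v` and `x` such that the path `vux` is rainbow. -/
def rainbowMiddle (v x : V) : Finset V :=
  Finset.univ.filter fun u => (G.Adj u v ∧ G.Adj u x) ∧ c s(u, x) ≠ c s(u, v)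

variable (G c) in
/-- The common neighbors `u` of `v` and `x` such that the path `vux` is not rainbow. -/
def plainMiddle (v x : V) : Finset V :=
  Finset.univ.filter fun u => (G.Adj u v ∧ G.Adj u x) ∧ c s(u, x) = c s(u, v)

variable (G c) in
/-- The values at `u` of the assignments `V → Fin 4` compatible with `x`. -/
def compatibleValues (v x u : V) : Finset (Fin 4) :=
  if G.Adj u v ∧ G.Adj u x then if c s(u, x) = c s(u, v) then {3} else {3}ᶜ else Finset.univ

lemma card_piFinset_compatibleValues (v x : V) :
    ((Fintype.piFinset (compatibleValues G c v x)).card : ℝ) = 4 ^ Fintype.card V *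
      ((3 / 4) ^ (rainbowMiddle G c v x).card * (1 / 4) ^ (plainMiddle G c v x).card) := by
  have h₁ : (3 / 4 : ℝ) ^ (rainbowMiddle G c v x).card =
      ∏ u, if (G.Adj u v ∧ G.Adj u x) ∧ c s(u, x) ≠ c s(u, v) then 3 / 4 else 1 := by
    rw [Finset.prod_ite, Finset.prod_const, Finset.prod_const_one, mul_one, rainbowMiddle]
  have h₂ : (1 / 4 : ℝ) ^ (plainMiddle G c v x).card =
      ∏ u, if (G.Adj u v ∧ G.Adj u x) ∧ c s(u, x) = c s(u, v) then 1 / 4 else 1 := by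
    rw [Finset.prod_ite, Finset.prod_const, Finset.prod_const_one, mul_one, plainMiddle]
  rw [Fintype.card_piFinset, h₁, h₂, ← Finset.prod_mul_distrib, ← Finset.card_univ,
    ← Finset.prod_const, ← Finset.prod_mul_distrib]
  push_cast
  refine Finset.prod_congr rfl fun u _ => ?_
  by_cases hu : G.Adj u v ∧ G.Adj u x <;> by_cases hc : c s(u, x) = c s(u, v) <;>
    norm_num [compatibleValues, hu, hc, Finset.card_compl]

/-- The weighted Kraft-type inequality for the vertices not adjacent to `v`. -/
lemma sum_nonNeighbors_le_two
    (hG : ∀ x y, x ≠ y → G.Adj x y ∨ ∃ z, G.Adj z x ∧ G.Adj z y ∧ c s(z, x) ≠ c s(z, y)) (v : V) :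
    ∑ x ∈ nonNeighbors G v, (3 / 4 : ℝ) ^ (rainbowMiddle G c v x).card *
      (1 / 4) ^ (plainMiddle G c v x).card * (1 / 2) ^ (farGraph G v).degree x ≤ 2 := by
  have hφ : ∀ φ : V → Fin 4, ∑ x ∈ nonNeighbors G v with
      φ ∈ Fintype.piFinset (compatibleValues G c v x),
      (1 / 2 : ℝ) ^ (farGraph G v).degree x ≤ 2 := by
    intro φ
    refine sum_half_pow_degree_le_two (c := c) ?_
    intro x hx y hy hxy
    simp only [Finset.mem_filter, Fintype.mem_piFinset] at hx hy
    rcases hG x y hxy with h | ⟨z, hzx, hzy, hne⟩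
    · exact .inl ⟨h, hx.1, hy.1⟩
    · have hzv : z ≠ v := by
        rintro rfl
        have := hx.1
        simp only [nonNeighbors, Finset.mem_filter] at this
        exact this.2.2 hzx.symm
      by_cases hz : G.Adj z v
      · have h₁ := hx.2 z
        have h₂ := hy.2 z
        simp only [compatibleValues, hz, hzx, hzy, and_self, if_true] at h₁ h₂
        exfalso
        split_ifs at h₁ h₂ with h₃ h₄ h₄
        · exact hne (h₃.trans h₄.symm)
        · simp_all
        · simp_all
        · revert h₃ h₄ hne
          generalize c s(z, x) = a, c s(z, y) = b, c s(z, v) = d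
          revert a b d
          decide
      · have hzA : z ∈ nonNeighbors G v := by simp [nonNeighbors, hzv, hz]
        exact .inr ⟨z, ⟨hzx, hzA, hx.1⟩, ⟨hzy, hzA, hy.1⟩, hne⟩
  have hsum := Finset.sum_le_sum fun φ (_ : φ ∈ Finset.univ) => hφ φ
  simp only [Finset.sum_filter] at hsum
  rw [Finset.sum_comm] at hsum
  have hcard : ∀ x, (∑ φ : V → Fin 4, if φ ∈ Fintype.piFinset (compatibleValues G c v x) then
      (1 / 2 : ℝ) ^ (farGraph G v).degree x else 0) = 4 ^ Fintype.card V *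
      ((3 / 4 : ℝ) ^ (rainbowMiddle G c v x).card *
      (1 / 4) ^ (plainMiddle G c v x).card * (1 / 2) ^ (farGraph G v).degree x) := by
    intro x
    rw [← Finset.sum_filter, Finset.sum_const, Finset.filter_univ_mem, nsmul_eq_mul,
      card_piFinset_compatibleValues]
    ring
  simp only [hcard] at hsum
  rw [← Finset.mul_sum] at hsum
  have : (∑ _φ : V → Fin 4, (2 : ℝ)) = 4 ^ Fintype.card V * 2 := by simp
  rw [this] at hsum
  exact le_of_mul_le_mul_left hsum (by positivity)

lemma degree_nonNeighbor {v x : V} (hx : x ∈ nonNeighbors G v) :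
    G.degree x = (rainbowMiddle G c v x).card + (plainMiddle G c v x).card +
      (farGraph G v).degree x := by
  have hx' := hx
  simp only [nonNeighbors, Finset.mem_filter, Finset.mem_univ, true_and] at hx'
  rw [← card_neighborFinset_eq_degree, ← card_neighborFinset_eq_degree,
    ← Finset.card_union_of_disjoint, ← Finset.card_union_of_disjoint]
  · congr 1
    ext u
    simp only [mem_neighborFinset, Finset.mem_union, rainbowMiddle, plainMiddle,
      Finset.mem_filter, Finset.mem_univ, true_and, farGraph_adj, G.adj_comm x u]
    constructor
    · intro h
      by_cases huv : G.Adj u v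
      · by_cases hc : c s(u, x) = c s(u, v) <;> simp [huv, h, hc]
      · refine .inr ⟨h, hx', ?_, huv⟩
        rintro rfl
        exact hx'.2 h.symm
    · tauto
  · rw [Finset.disjoint_left]
    intro u hu hu'
    simp only [mem_neighborFinset, Finset.mem_union, rainbowMiddle, plainMiddle,
      Finset.mem_filter, Finset.mem_univ, true_and, farGraph_adj] at hu hu'
    tauto
  · rw [Finset.disjoint_left]
    intro u hu hu'
    simp only [rainbowMiddle, plainMiddle, Finset.mem_filter] at hu hu'
    tauto

lemma card_nonNeighbors (v : V) :
    (nonNeighbors G v).card + G.degree v + 1 = Fintype.card V := by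
  have h : nonNeighbors G v = (insert v (G.neighborFinset v))ᶜ := by
    ext x
    simp [nonNeighbors, G.adj_comm x v]
  have h₂ := Finset.card_compl_add_card (insert v (G.neighborFinset v))
  rw [← h, Finset.card_insert_of_notMem (by simp), card_neighborFinset_eq_degree] at h₂
  omega

lemma two_mul_degree_add_sum_le (v : V) :
    2 * G.degree v + ∑ x ∈ nonNeighbors G v, (2 * (rainbowMiddle G c v x).card +
      2 * (plainMiddle G c v x).card + (farGraph G v).degree x) ≤ 2 * G.edgeFinset.card := by
  have hsplit : ∑ x, G.degree x = G.degree v + ∑ u ∈ G.neighborFinset v, G.degree u +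
      ∑ x ∈ nonNeighbors G v, G.degree x := by
    have h : nonNeighbors G v = (insert v (G.neighborFinset v))ᶜ := by
      ext x
      simp [nonNeighbors, G.adj_comm x v]
    rw [h, ← Finset.sum_add_sum_compl (insert v (G.neighborFinset v)),
      Finset.sum_insert (by simp)]
  have hmiddle : ∀ x, (rainbowMiddle G c v x).card + (plainMiddle G c v x).card =
      ((G.neighborFinset v).filter fun u => G.Adj u x).card := by
    intro x
    rw [← Finset.card_union_of_disjoint]
    · congr 1
      ext u
      simp only [mem_neighborFinset, Finset.mem_union, rainbowMiddle, plainMiddle,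
        Finset.mem_filter, Finset.mem_univ, true_and, G.adj_comm v u]
      tauto
    · rw [Finset.disjoint_left]
      intro u hu hu'
      simp only [rainbowMiddle, plainMiddle, Finset.mem_filter] at hu hu'
      tauto
  have hnbr : G.degree v + ∑ x ∈ nonNeighbors G v, ((rainbowMiddle G c v x).card +
      (plainMiddle G c v x).card) ≤ ∑ u ∈ G.neighborFinset v, G.degree u := by
    have : ∀ u ∈ G.neighborFinset v,
        1 + ((nonNeighbors G v).filter fun x => G.Adj u x).card ≤ G.degree u := by
      intro u hu
      rw [add_comm, ← Finset.card_insert_of_notMem (a := v) (by simp [nonNeighbors]),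
        ← card_neighborFinset_eq_degree]
      refine Finset.card_le_card fun x hx => ?_
      simp only [Finset.mem_insert, Finset.mem_filter, mem_neighborFinset] at hx hu ⊢
      rcases hx with rfl | hx
      · exact hu.symm
      · exact hx.2
    refine le_trans (le_of_eq ?_) (Finset.sum_le_sum this)
    rw [Finset.sum_add_distrib (s := G.neighborFinset v), Finset.sum_const,
      card_neighborFinset_eq_degree, smul_eq_mul, mul_one]
    simp only [hmiddle, Finset.card_filter]
    rw [Finset.sum_comm]
  have hfar : ∑ x ∈ nonNeighbors G v, G.degree x =
      ∑ x ∈ nonNeighbors G v, ((rainbowMiddle G c v x).card + (plainMiddle G c v x).card) +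
      ∑ x ∈ nonNeighbors G v, (farGraph G v).degree x := by
    rw [← Finset.sum_add_distrib]
    exact Finset.sum_congr rfl fun x hx => degree_nonNeighbor hx
  have hgoal : ∑ x ∈ nonNeighbors G v, (2 * (rainbowMiddle G c v x).card +
      2 * (plainMiddle G c v x).card + (farGraph G v).degree x) =
      2 * ∑ x ∈ nonNeighbors G v, ((rainbowMiddle G c v x).card + (plainMiddle G c v x).card) +
      ∑ x ∈ nonNeighbors G v, (farGraph G v).degree x := by
    rw [Finset.mul_sum, ← Finset.sum_add_distrib]
    exact Finset.sum_congr rfl fun x _ => by ring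
  rw [← sum_degrees_eq_twice_card_edges, hsplit, hgoal]
  omega

lemma rainbowMiddle_card_pos
    (hG : ∀ x y, x ≠ y → G.Adj x y ∨ ∃ z, G.Adj z x ∧ G.Adj z y ∧ c s(z, x) ≠ c s(z, y))
    {v x : V} (hx : x ∈ nonNeighbors G v) : 1 ≤ (rainbowMiddle G c v x).card := by
  simp only [nonNeighbors, Finset.mem_filter, Finset.mem_univ, true_and] at hx
  obtain ⟨z, hzx, hzv, hne⟩ := (hG x v hx.1).resolve_left hx.2
  exact Finset.card_pos.2 ⟨z, by simp [rainbowMiddle, hzx, hzv, hne]⟩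

end LowDegreeVertex

/-- The inequality obtained from concavity of the logarithm: if positive weights have sum at most
two, then their logarithms are small on average. -/
lemma sum_log_le {ι : Type*} (A : Finset ι) (w : ι → ℝ) (hw : ∀ x ∈ A, 0 < w x)
    (h : ∑ x ∈ A, w x ≤ 2) (hA : 0 < A.card) :
    ∑ x ∈ A, Real.log (w x) ≤ - (A.card * Real.log (A.card / 2)) := by
  have hm : (0 : ℝ) < A.card := by exact_mod_cast hA
  have h₁ : ∀ x ∈ A, Real.log (w x) ≤ w x * (A.card / 2) - 1 - Real.log (A.card / 2) := by
    intro x hx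
    have := Real.log_le_sub_one_of_pos (mul_pos (hw x hx) (half_pos hm))
    rw [Real.log_mul (hw x hx).ne' (half_pos hm).ne'] at this
    linarith
  refine (Finset.sum_le_sum h₁).trans ?_
  rw [Finset.sum_sub_distrib, Finset.sum_sub_distrib, ← Finset.sum_mul]
  simp only [Finset.sum_const, nsmul_eq_mul, mul_one]
  nlinarith

/-- A lower bound for the number of edges in terms of the degree of any vertex `v`. -/
lemma two_mul_degree_add_mul_logb_le {V : Type*} [Fintype V] [DecidableEq V] {G : SimpleGraph V}
    [DecidableRel G.Adj] {c : Sym2 V → Bool}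
    (hG : ∀ x y, x ≠ y → G.Adj x y ∨ ∃ z, G.Adj z x ∧ G.Adj z y ∧ c s(z, x) ≠ c s(z, y)) (v : V)
    (hv : 0 < (nonNeighbors G v).card) :
    2 * (G.degree v : ℝ) + (nonNeighbors G v).card *
      Real.logb 2 ((nonNeighbors G v).card * (3 / 2)) ≤ 2 * G.edgeFinset.card := by
  have hm : (0 : ℝ) < (nonNeighbors G v).card := by exact_mod_cast hv
  have hedge : ((2 * G.degree v + ∑ x ∈ nonNeighbors G v, (2 * (rainbowMiddle G c v x).card +
      2 * (plainMiddle G c v x).card + (farGraph G v).degree x) : ℕ) : ℝ) ≤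
      (2 * G.edgeFinset.card : ℕ) := Nat.cast_le.2 (two_mul_degree_add_sum_le v)
  push_cast at hedge
  refine le_trans (add_le_add_right ?_ _) hedge
  have hlog := sum_log_le _ _ (fun x _ => by positivity) (sum_nonNeighbors_le_two hG v) hv
  have h2 : 0 < Real.log 2 := Real.log_pos one_lt_two
  have h3 : 0 < Real.log 3 := Real.log_pos (by norm_num)
  have hterm : ∀ x ∈ nonNeighbors G v, Real.log 3 - Real.log ((3 / 4 : ℝ) ^
      (rainbowMiddle G c v x).card * (1 / 4) ^ (plainMiddle G c v x).card *
      (1 / 2) ^ (farGraph G v).degree x) ≤ (2 * (rainbowMiddle G c v x).card +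
      2 * (plainMiddle G c v x).card + (farGraph G v).degree x) * Real.log 2 := by
    intro x hx
    have h4 : Real.log 4 = 2 * Real.log 2 := by
      rw [show (4 : ℝ) = 2 ^ 2 by norm_num, Real.log_pow]
      norm_num
    have hpos : (1 : ℝ) ≤ (rainbowMiddle G c v x).card := by
      exact_mod_cast rainbowMiddle_card_pos hG hx
    rw [Real.log_mul (by positivity) (by positivity), Real.log_mul (by positivity) (by positivity),
      Real.log_pow, Real.log_pow, Real.log_pow, Real.log_div (by norm_num) (by norm_num),
      Real.log_div (by norm_num) (by norm_num), Real.log_div (by norm_num) (by norm_num),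
      Real.log_one, h4]
    nlinarith
  have hsum := Finset.sum_le_sum hterm
  rw [Finset.sum_sub_distrib, ← Finset.sum_mul, Finset.sum_const, nsmul_eq_mul] at hsum
  rw [Real.logb, ← mul_div_assoc, div_le_iff₀ h2]
  have hl : Real.log ((nonNeighbors G v).card * (3 / 2)) =
      Real.log ((nonNeighbors G v).card / 2) + Real.log 3 := by
    rw [← Real.log_mul (by positivity) (by norm_num)]
    ring_nf
  rw [hl]
  linarith

theorem logb_two_le_mul_sub_one {x : ℝ} (hx : 1 ≤ x) : Real.logb 2 x ≤ 1.45 * (x - 1) := by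
  have h2 := Real.log_two_gt_d9
  have hlog := Real.log_le_sub_one_of_pos (by linarith : 0 < x)
  rw [Real.logb, div_le_iff₀ (by linarith)]
  nlinarith [mul_nonneg (sub_nonneg.2 hx) (by linarith : 0 ≤ Real.log 2 - 0.6931)]

theorem logb_two_sub_le_mul_logb {n k : ℝ} (hk : 0 ≤ k) (hkn : k < n) :
    (n - k) * Real.logb 2 n - 1.45 * k + (n - k) / 2 ≤
      (n - k) * Real.logb 2 ((n - k) * (3 / 2)) := by
  have hm : 0 < n - k := sub_pos.2 hkn
  have hratio := logb_two_le_mul_sub_one (x := n / (n - k)) ((one_le_div hm).2 (by linarith))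
  have hmul : (n - k) * (n / (n - k) - 1) = k := by
    field_simp
    ring
  rw [Real.logb_div (by linarith) hm.ne'] at hratio
  have hthree : (1 / 2 : ℝ) ≤ Real.logb 2 (3 / 2) := by
    have : (1 : ℝ) ≤ Real.logb 2 ((3 / 2) ^ 2) := by
      rw [Real.le_logb_iff_rpow_le one_lt_two (by norm_num)]
      norm_num
    rw [Real.logb_pow] at this
    push_cast at this
    linarith
  rw [Real.logb_mul hm.ne' (by norm_num)]
  nlinarith [mul_le_mul_of_nonneg_left hratio hm.le, mul_le_mul_of_nonneg_left hthree hm.le]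

theorem two_rpow_le_of_le_logb {n a : ℝ} (hn : 0 < n) (h : a ≤ Real.logb 2 n) : 2 ^ a ≤ n :=
  (Real.le_logb_iff_rpow_le one_lt_two hn).1 h

theorem sq_logb_add_logb_le {n : ℝ} (hn : 256 ≤ n) :
    Real.logb 2 n ^ 2 + Real.logb 2 n + 2 ≤ n / 2 := by
  obtain ⟨s, hs, hsn⟩ : ∃ s : ℝ, 0 ≤ s ∧ n = (16 * (1 + s)) ^ 2 := by
    refine ⟨√n / 16 - 1, ?_, ?_⟩
    · have : (16 : ℝ) ≤ √n := Real.le_sqrt_of_sq_le (by linarith)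
      linarith
    · have := Real.sq_sqrt (by linarith : 0 ≤ n)
      nlinarith
  have hL : Real.logb 2 n = 2 * (4 + Real.logb 2 (1 + s)) := by
    rw [hsn, Real.logb_pow, Real.logb_mul (by norm_num) (by positivity),
      show (16 : ℝ) = 2 ^ (4 : ℕ) by norm_num, Real.logb_pow, Real.logb_self_eq_one one_lt_two]
    norm_num
  have hle : Real.logb 2 (1 + s) ≤ 1.45 * s := by
    simpa using logb_two_le_mul_sub_one (x := 1 + s) (by linarith)
  have hnonneg : 0 ≤ Real.logb 2 (1 + s) := Real.logb_nonneg one_lt_two (by linarith)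
  rw [hL, hsn]
  nlinarith

theorem sq_logb_add_logb_le_of_lt {n : ℝ} (hn : 16 ≤ n) (hn' : n < 256) :
    Real.logb 2 n ^ 2 + Real.logb 2 n + 2 ≤ n * (8.5 - Real.logb 2 n) := by
  have hpos : 0 < n := by linarith
  have h8 : Real.logb 2 n < 8 := by
    rw [Real.logb_lt_iff_lt_rpow one_lt_two hpos]
    norm_num
    exact hn'
  have h4 : 4 ≤ Real.logb 2 n := by
    rw [Real.le_logb_iff_rpow_le one_lt_two hpos]
    norm_num
    exact hn
  have hpow := fun a : ℝ => two_rpow_le_of_le_logb (a := a) hpos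
  generalize Real.logb 2 n = L at *
  rcases le_total L 5 with h5 | h5
  · nlinarith
  have hn5 := hpow 5 h5
  norm_num at hn5
  rcases le_total L 6 with h6 | h6
  · nlinarith
  have hn6 := hpow 6 h6
  norm_num at hn6
  rcases le_total L 7 with h7 | h7
  · nlinarith
  have hn7 := hpow 7 h7
  norm_num at hn7
  rcases le_total L 7.5 with h | h
  · nlinarith
  have hn75 : (160 : ℝ) ≤ n := by
    have h1 := hpow 7.5 h
    have h2 : ((2 : ℝ) ^ (7.5 : ℝ)) ^ 2 = 2 ^ 15 := by
      rw [← Real.rpow_mul_natCast zero_le_two]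
      norm_num
    have h3 : (0 : ℝ) < 2 ^ (7.5 : ℝ) := by positivity
    nlinarith
  nlinarith

theorem min_le_of_two_mul_add_mul_logb_le {n d e : ℝ} (hn : 16 ≤ n) (hd : 0 ≤ d)
    (hdL : d < Real.logb 2 n) (hdn : d + 1 < n)
    (he : 2 * d + (n - (d + 1)) * Real.logb 2 ((n - (d + 1)) * (3 / 2)) ≤ 2 * e) :
    min (n / 2 * Real.logb 2 n) (n * Real.logb 2 n - 4 * n) ≤ e := by
  have hbound := logb_two_sub_le_mul_logb (by linarith : 0 ≤ d + 1) hdn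
  have hprod : (d + 1) * Real.logb 2 n ≤ (Real.logb 2 n + 1) * Real.logb 2 n :=
    mul_le_mul_of_nonneg_right (by linarith) (by linarith)
  rcases le_or_gt 256 n with hlarge | hsmall
  · refine min_le_of_left_le ?_
    linarith [sq_logb_add_logb_le hlarge]
  · refine min_le_of_right_le ?_
    linarith [sq_logb_add_logb_le_of_lt hn hsmall]

theorem IsRainbowEdgeColoring.adj_or_exists_adj_ne {V : Type*} {G : SimpleGraph V}
    {c : Sym2 V → Fin 2} (hc : IsRainbowEdgeColoring G c) {x y : V} (hxy : x ≠ y) :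
    G.Adj x y ∨ ∃ z, G.Adj z x ∧ G.Adj z y ∧ c s(z, x) ≠ c s(z, y) := by
  obtain ⟨p, -, hp⟩ := hc x y hxy
  have hlen : p.length ≤ 2 := by simpa using hp.length_le_card
  match p with
  | .nil => exact absurd rfl hxy
  | .cons hadj .nil => exact Or.inl hadj
  | .cons (v := z) hxz (.cons hzy .nil) =>
    refine Or.inr ⟨z, hxz.symm, hzy, ?_⟩
    simpa [Sym2.eq_swap] using hp
  | .cons _ (.cons _ (.cons _ q)) => simp at hlen

theorem exists_isRainbowEdgeColoring_of_rainbowConnNum_eq_two {V : Type*} {G : SimpleGraph V}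
    (hG : rainbowConnNum G = 2) : ∃ c : Sym2 V → Fin 2, IsRainbowEdgeColoring G c := by
  have hmem := Nat.sInf_mem (Nat.nonempty_of_pos_sInf
    (s := {k | ∃ c : Sym2 V → Fin k, IsRainbowEdgeColoring G c})
    (by rw [← rainbowConnNum, hG]; exact two_pos))
  rwa [← rainbowConnNum, hG] at hmem

theorem IsRainbowEdgeColoring.min_le_card_edgeFinset {V : Type*} [Fintype V] [DecidableEq V]
    {G : SimpleGraph V} [DecidableRel G.Adj] {c : Sym2 V → Fin 2}
    (hc : IsRainbowEdgeColoring G c) (hV : 16 ≤ Fintype.card V) :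
    min ((Fintype.card V : ℝ) / 2 * Real.logb 2 (Fintype.card V))
      (Fintype.card V * Real.logb 2 (Fintype.card V) - 4 * Fintype.card V) ≤
      G.edgeFinset.card := by
  have hV' : (16 : ℝ) ≤ Fintype.card V := by exact_mod_cast hV
  by_cases hdeg : ∀ v, Real.logb 2 (Fintype.card V) ≤ G.degree v
  · refine min_le_of_left_le ?_
    have hsum := Finset.card_nsmul_le_sum Finset.univ (fun v => (G.degree v : ℝ)) _
      fun v _ => hdeg v
    rw [← Nat.cast_sum, G.sum_degrees_eq_twice_card_edges, nsmul_eq_mul, Finset.card_univ] at hsum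
    push_cast at hsum
    linarith
  · push Not at hdeg
    obtain ⟨v, hv⟩ := hdeg
    have hlog : Real.logb 2 (Fintype.card V : ℝ) + 1 < Fintype.card V := by
      have h := logb_two_le_mul_sub_one (x := Fintype.card V / 16) (by linarith)
      rw [Real.logb_div (by linarith) (by norm_num), show (16 : ℝ) = 2 ^ (4 : ℕ) by norm_num,
        Real.logb_pow, Real.logb_self_eq_one one_lt_two] at h
      norm_num at h
      linarith
    have hcard : ((nonNeighbors G v).card : ℝ) = Fintype.card V - (G.degree v + 1) := by
      rw [← card_nonNeighbors (G := G) v]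
      push_cast
      ring
    have hpos : 0 < (nonNeighbors G v).card := by
      rw [← Nat.cast_pos (α := ℝ), hcard]
      linarith
    have hkey := two_mul_degree_add_mul_logb_le (G := G) (c := fun e => decide (c e = 0))
      (fun x y hxy => (hc.adj_or_exists_adj_ne hxy).imp_right fun ⟨z, hzx, hzy, hne⟩ =>
        ⟨z, hzx, hzy, fun h => hne (by simp only [decide_eq_decide] at h; omega)⟩) v hpos
    rw [hcard] at hkey
    exact min_le_of_two_mul_add_mul_logb_le hV' (Nat.cast_nonneg _) hv (by linarith) hkey

theorem e2_lower_bound (n : ℕ) (hn : 2 ≤ n)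
    (h : ∃ G : SimpleGraph (Fin n), rainbowConnNum G = 2) :
    min ((n : ℝ) / 2 * Real.logb 2 n) ((n : ℝ) * Real.logb 2 n - 4 * n) ≤ (e2 n : ℝ) := by
  rcases lt_or_ge n 16 with hsmall | hlarge
  · refine min_le_of_right_le (le_trans ?_ (Nat.cast_nonneg _))
    have hlog : Real.logb 2 n ≤ 4 := by
      rw [Real.logb_le_iff_le_rpow one_lt_two (by positivity)]
      norm_num
      exact_mod_cast hsmall.le
    nlinarith [(Nat.cast_nonneg n : (0 : ℝ) ≤ n)]
  · classical
    obtain ⟨G, hG⟩ := h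
    obtain ⟨H, hH, hcard⟩ := Nat.sInf_mem (s := {m | ∃ G : SimpleGraph (Fin n),
      rainbowConnNum G = 2 ∧ G.edgeSet.ncard = m}) ⟨_, G, hG, rfl⟩
    obtain ⟨c, hc⟩ := exists_isRainbowEdgeColoring_of_rainbowConnNum_eq_two hH
    rw [e2, ← hcard, ← H.coe_edgeFinset, Set.ncard_coe_finset]
    simpa using hc.min_le_card_edgeFinset (by simpa using hlarge)
end

section
/- Let $G$ be a graph with an edge-coloring $c$ using $2$ colors such that every two distinct vertices of $G$ are connected by a rainbow path. Let $T \subseteq V(G)$ and let $u, v$ be two distinct vertices of $G$ not in $T$ such that for every vertex $w \in T$ adjacent to both $u$ and $v$, $c(uw) = c(vw)$. Then in the induced subgraph $G[V(G) \setminus T]$, the distance between $u$ and $v$ is at most $2$. -/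
open SimpleGraph

theorem dist_le_two_outside_T {V : Type*} (G : SimpleGraph V) (c : Sym2 V → Fin 2)
    (hc : IsRainbowEdgeColoring G c) (T : Set V) (u v : V)
    (hu : u ∉ T) (hv : v ∉ T) (huv : u ≠ v)
    (h : ∀ w ∈ T, G.Adj u w → G.Adj v w → c s(u, w) = c s(v, w)) :
    ∃ p : (G.induce Tᶜ).Walk ⟨u, hu⟩ ⟨v, hv⟩, p.length ≤ 2 := by
  obtain ⟨p, -, hp⟩ := hc u v huv
  cases p with
  | nil => exact absurd rfl huv
  | @cons _ w _ huw q =>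
    cases q with
    | nil =>
      have hadj : (G.induce Tᶜ).Adj ⟨u, hu⟩ ⟨v, hv⟩ := huw
      exact ⟨hadj.toWalk, by simp⟩
    | @cons _ x _ hwx r =>
      cases r with
      | nil =>
        have hw : w ∉ T := fun hw => by
          have hcol := h w hw huw hwx.symm
          simp [Sym2.eq_swap (a := v) (b := w)] at hcol hp
          exact hp hcol
        have huw' : (G.induce Tᶜ).Adj ⟨u, hu⟩ ⟨w, hw⟩ := huw
        have hwv' : (G.induce Tᶜ).Adj ⟨w, hw⟩ ⟨v, hv⟩ := hwx
        exact ⟨.cons huw' hwv'.toWalk, by simp⟩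
      | cons _ q =>
        have hlen := hp.length_le_card
        simp at hlen
end

section
/- Let $G$ be a tree of order $n$ with exactly $k$ leaves, where $n - k \ge 2$. Then the rainbow vertex connection number of $G$ satisfies $rvc(G) = n - k$. -/
open SimpleGraph

namespace SimpleGraph

variable {V : Type*} {G : SimpleGraph V}

lemma exists_adj_ne_of_ncard_neighborSet_ne_one {x s : V}
    (hx : (G.neighborSet x).ncard ≠ 1) (hs : G.Adj x s) : ∃ u, G.Adj x u ∧ u ≠ s := by
  by_contra! h
  exact hx (Set.ncard_eq_one.mpr ⟨s, Set.ext fun u => ⟨h u, fun hu => hu ▸ hs⟩⟩)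

lemma Walk.IsPath.ncard_neighborSet_ne_one_of_mem_tail_dropLast {u v z : V} {p : G.Walk u v}
    (hp : p.IsPath) (hz : z ∈ p.support.tail.dropLast) : (G.neighborSet z).ncard ≠ 1 := by
  obtain ⟨i, hi, rfl⟩ := List.mem_iff_getElem.mp hz
  have hlen : i + 1 < p.length := by
    simp only [List.length_dropLast, List.length_tail, Walk.length_support] at hi
    omega
  simp only [List.getElem_dropLast, List.getElem_tail, ← Walk.getVert_eq_support_getElem _ hlen.le]
  intro h
  obtain ⟨a, ha⟩ := Set.ncard_eq_one.mp h
  have hprev : p.getVert i ∈ G.neighborSet (p.getVert (i + 1)) :=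
    (p.adj_getVert_succ (by omega)).symm
  have hnext : p.getVert (i + 2) ∈ G.neighborSet (p.getVert (i + 1)) :=
    p.adj_getVert_succ hlen
  rw [ha, Set.mem_singleton_iff] at hprev hnext
  have := hp.getVert_injOn (Set.mem_ofPred.mpr (by omega : i ≤ p.length))
    (Set.mem_ofPred.mpr (by omega : i + 2 ≤ p.length)) (hprev.trans hnext.symm)
  omega

end SimpleGraph

lemma IsRainbowVertexColoring.injOn_of_isAcyclic {V α : Type*} {G : SimpleGraph V} {c : V → α}
    (hc : IsRainbowVertexColoring G c) (hG : G.IsAcyclic) (hconn : G.Preconnected) :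
    Set.InjOn c {v | (G.neighborSet v).ncard ≠ 1} := by
  intro x hx y hy hxy
  by_contra hne
  obtain ⟨p, hp⟩ := (hconn x y).exists_isPath
  have hnil : ¬ p.Nil := fun h => hne h.eq
  obtain ⟨u, hxu, hu⟩ := exists_adj_ne_of_ncard_neighborSet_ne_one hx (p.adj_snd hnil)
  have hup : u ∉ p.support := fun h => hu (hG.eq_snd_of_adj_start hp hxu h)
  have hq : (p.cons hxu.symm).IsPath := hp.cons hup
  obtain ⟨w, hyw, hw⟩ := exists_adj_ne_of_ncard_neighborSet_ne_one hy
    ((p.cons hxu.symm).adj_penultimate Walk.not_nil_cons).symm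
  have hwq : w ∉ (p.cons hxu.symm).support := fun h =>
    hw (hG.eq_penultimate_of_adj_end hq hyw h)
  have hr := hq.concat hwq hyw
  have huw : u ≠ w := by
    rintro rfl
    simp at hwq
  obtain ⟨r, hr', hnodup⟩ := hc u w huw
  obtain rfl : r = (p.cons hxu.symm).concat hyw :=
    congrArg Subtype.val ((hG.subsingleton_path u w).elim ⟨r, hr'⟩ ⟨_, hr⟩)
  have hsupp : ((p.cons hxu.symm).concat hyw).support.tail.dropLast = p.support := by
    simp [Walk.support_concat]
  rw [hsupp] at hnodup
  exact hne (List.inj_on_of_nodup_map hnodup p.start_mem_support p.end_mem_support hxy)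

lemma SimpleGraph.Connected.isRainbowVertexColoring_of_injOn {V α : Type*} {G : SimpleGraph V}
    {c : V → α} (hG : G.Connected) (hc : Set.InjOn c {v | (G.neighborSet v).ncard ≠ 1}) :
    IsRainbowVertexColoring G c := by
  intro u v _
  obtain ⟨p, hp⟩ := (hG u v).exists_isPath
  refine ⟨p, hp, List.Nodup.map_on (fun x hx y hy h => hc ?_ ?_ h) ?_⟩
  · exact hp.ncard_neighborSet_ne_one_of_mem_tail_dropLast hx
  · exact hp.ncard_neighborSet_ne_one_of_mem_tail_dropLast hy
  · exact (hp.support_nodup.sublist (List.tail_sublist _)).sublist (List.dropLast_sublist _)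

theorem rvc_tree {V : Type*} [Fintype V] (G : SimpleGraph V) (hG : G.IsTree)
    (k : ℕ) (hk : {v : V | (G.neighborSet v).ncard = 1}.ncard = k)
    (h2 : 2 ≤ Fintype.card V - k) :
    rvcNum G = Fintype.card V - k := by
  have hcard : {v : V | (G.neighborSet v).ncard ≠ 1}.ncard = Fintype.card V - k := by
    have h := Set.ncard_compl {v : V | (G.neighborSet v).ncard = 1}
    rwa [hk, Nat.card_eq_fintype_card] at h
  refine IsLeast.csInf_eq ⟨?_, ?_⟩
  · have : Nonempty (Fin (Fintype.card V - k)) := ⟨⟨0, by omega⟩⟩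
    obtain ⟨c, -, hc⟩ := Set.Finite.exists_injOn_of_encard_le
      (s := {v : V | (G.neighborSet v).ncard ≠ 1})
      (t := (Set.univ : Set (Fin (Fintype.card V - k)))) (Set.toFinite _) (by
        rw [← (Set.toFinite _).cast_ncard_eq, hcard]
        simp)
    exact ⟨c, hG.connected.isRainbowVertexColoring_of_injOn hc⟩
  · rintro m ⟨c, hc⟩
    rw [← hcard, ← Set.InjOn.ncard_image
      (hc.injOn_of_isAcyclic hG.isAcyclic hG.connected.preconnected)]
    exact (Set.ncard_le_card _).trans_eq (by simp)
end

section
/- For every integer $n \ge 2$ there exists an integer $k \ge 1$ such that $k + 2^{k-1} \le n \le k + 2^k$, and for such $k$ the complete bipartite graph $K_{k,n-k}$ satisfies $e(K_{k,n-k}) = k(n-k) \le n\lceil \log_2 n \rceil - (\lfloor \log_2 n \rfloor - 1)^2$. -/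
open SimpleGraph

theorem exists_one_le_add_two_pow_le (n : ℕ) (hn : 2 ≤ n) :
    ∃ k : ℕ, 1 ≤ k ∧ k + 2 ^ (k - 1) ≤ n ∧ n ≤ k + 2 ^ k := by
  have hex : ∃ k : ℕ, n ≤ k + 2 ^ k := ⟨n, Nat.le_add_right _ _⟩
  have hspec := Nat.find_spec hex
  have hmin := fun m => Nat.find_min hex (m := m)
  generalize Nat.find hex = k at hspec hmin
  cases k with
  | zero => norm_num at hspec; omega
  | succ j =>
    have h := hmin j (Nat.lt_succ_self j)
    exact ⟨j + 1, by omega, by simp only [Nat.add_sub_cancel]; omega, hspec⟩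

theorem ncard_edgeSet_completeBipartiteGraph_fin (a b : ℕ) :
    (completeBipartiteGraph (Fin a) (Fin b)).edgeSet.ncard = a * b := by
  rw [Set.ncard, encard_edgeSet_completeBipartiteGraph]
  simp

theorem le_ceil_logb_two {n k : ℕ} (hk : 1 ≤ k) (h : k + 2 ^ (k - 1) ≤ n) :
    (k : ℤ) ≤ ⌈Real.logb 2 n⌉ := by
  obtain ⟨j, rfl⟩ := Nat.exists_eq_add_of_le' hk
  rw [Nat.add_sub_cancel] at h
  have hlt : ((2 : ℝ) ^ j) < n := by
    exact_mod_cast (show 2 ^ j < n by omega)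
  have hn : (0 : ℝ) < n := lt_trans (by positivity) hlt
  have : (j : ℝ) < Real.logb 2 n := by
    rw [Real.lt_logb_iff_rpow_lt (by norm_num) hn, Real.rpow_natCast]
    exact hlt
  have h' : (j : ℤ) < ⌈Real.logb 2 n⌉ := Int.lt_ceil.mpr (by exact_mod_cast this)
  push_cast
  omega

theorem floor_logb_two_le {n k : ℕ} (hn : 0 < n) (h : n ≤ k + 2 ^ k) :
    ⌊Real.logb 2 n⌋ ≤ (k : ℤ) := by
  have hlt : (n : ℝ) < 2 ^ (k + 1) := by
    have := Nat.lt_two_pow_self (n := k)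
    exact_mod_cast (show n < 2 ^ (k + 1) by rw [pow_succ]; omega)
  have : Real.logb 2 n < ((k + 1 : ℕ) : ℝ) := by
    rw [Real.logb_lt_iff_lt_rpow (by norm_num) (by exact_mod_cast hn), Real.rpow_natCast]
    exact hlt
  have h' : ⌊Real.logb 2 n⌋ < (k : ℤ) + 1 := Int.floor_lt.mpr (by exact_mod_cast this)
  omega

theorem exists_k_and_edge_bound (n : ℕ) (hn : 2 ≤ n) :
    (∃ k : ℕ, 1 ≤ k ∧ k + 2 ^ (k - 1) ≤ n ∧ n ≤ k + 2 ^ k) ∧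
      ∀ k : ℕ, 1 ≤ k → k + 2 ^ (k - 1) ≤ n → n ≤ k + 2 ^ k →
        (completeBipartiteGraph (Fin k) (Fin (n - k))).edgeSet.ncard = k * (n - k) ∧
          ((k * (n - k) : ℕ) : ℝ) ≤
            n * (⌈Real.logb 2 n⌉ : ℝ) - ((⌊Real.logb 2 n⌋ : ℝ) - 1) ^ 2 := by
  refine ⟨exists_one_le_add_two_pow_le n hn, fun k hk hlow hup =>
    ⟨ncard_edgeSet_completeBipartiteGraph_fin k (n - k), ?_⟩⟩
  have hceil : (k : ℝ) ≤ ⌈Real.logb 2 n⌉ := by exact_mod_cast le_ceil_logb_two hk hlow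
  have hfloor : (⌊Real.logb 2 n⌋ : ℝ) ≤ k := by
    exact_mod_cast floor_logb_two_le (by omega) hup
  have hfloor_pos : (0 : ℝ) ≤ ⌊Real.logb 2 n⌋ := by
    have h1 : (1 : ℝ) ≤ n := by exact_mod_cast (by omega : 1 ≤ n)
    exact_mod_cast Int.floor_nonneg.mpr (Real.logb_nonneg (by norm_num) h1)
  have hk' : (1 : ℝ) ≤ k := by exact_mod_cast hk
  have hsq : ((⌊Real.logb 2 n⌋ : ℝ) - 1) ^ 2 ≤ (k : ℝ) ^ 2 :=
    sq_le_sq' (by linarith) (by linarith)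
  have hmul := mul_le_mul_of_nonneg_left hceil (Nat.cast_nonneg (α := ℝ) n)
  rw [Nat.cast_mul, Nat.cast_sub (le_of_add_le_left hlow)]
  linarith
end
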